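/- arXiv:1305.5295 — 3 statements merged into one kernel-verified Lean document; each statement's English description precedes it below -/
import Mathlib

section
/- Let F be a field, p a prime not equal to the characteristic of F, and suppose F has the C_n property. Let m be a positive integer with 2^{m-1} > p^{n-2} (equivalently, m ≥ ⌈(n−2)·log_2(p) + 1⌉). Then K_{m+1}^M(F)/pK_{m+1}^M(F) = 0. -/
universe u

open MvPolynomial

/-- A field `F` has the `C_n` property if every homogeneous polynomial of
positive degree `d` in more than `d ^ n` variables has a nontrivial zero. -/
def IsCField (F : Type u) [Field F] (n : ℕ) : Prop :=
  ∀ (d N : ℕ), 0 < d → d ^ n < N →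
    ∀ f : MvPolynomial (Fin N) F, f.IsHomogeneous d →
      ∃ x : Fin N → F, x ≠ 0 ∧ MvPolynomial.eval x f = 0

variable (F : Type u) [Field F]

/-- Multilinearity relations for Milnor K-theory. -/
def mlRel (n : ℕ) : Set (FreeAbelianGroup (Fin n → Fˣ)) :=
  {z | ∃ (a : Fin n → Fˣ) (i : Fin n) (u v : Fˣ), a i = u * v ∧
        z = FreeAbelianGroup.of a - FreeAbelianGroup.of (Function.update a i u)
              - FreeAbelianGroup.of (Function.update a i v)}

/-- Steinberg relations for Milnor K-theory. -/
def stRel (n : ℕ) : Set (FreeAbelianGroup (Fin n → Fˣ)) :=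
  {z | ∃ (a : Fin n → Fˣ) (i j : Fin n), (i : ℕ) + 1 = (j : ℕ) ∧
        ((a i : F) + (a j : F) = 1) ∧ z = FreeAbelianGroup.of a}

/-- The subgroup of relations defining the `n`-th Milnor K-group. -/
def milnorRel (n : ℕ) : AddSubgroup (FreeAbelianGroup (Fin n → Fˣ)) :=
  AddSubgroup.closure (mlRel F n ∪ stRel F n)

/-- The `n`-th Milnor K-group `K_n^M(F)`. -/
def MilnorK (n : ℕ) : Type u :=
  FreeAbelianGroup (Fin n → Fˣ) ⧸ milnorRel F n

instance (n : ℕ) : AddCommGroup (MilnorK F n) :=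
  QuotientAddGroup.Quotient.addCommGroup _

/-- The subgroup `p·K_n^M(F)` of `K_n^M(F)`. -/
def pMul (p n : ℕ) : AddSubgroup (MilnorK F n) :=
  AddSubgroup.closure {x | ∃ y : MilnorK F n, x = p • y}

/-- `k_n(F) = K_n^M(F)/pK_n^M(F)`. -/
def kMod (p n : ℕ) : Type u := MilnorK F n ⧸ pMul F p n

instance (p n : ℕ) : AddCommGroup (kMod F p n) :=
  QuotientAddGroup.Quotient.addCommGroup _

/-- The symbol `(a 1, …, a n)` in `k_n(F)`. -/
def symbol (p : ℕ) {n : ℕ} (a : Fin n → Fˣ) : kMod F p n :=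
  QuotientAddGroup.mk (QuotientAddGroup.mk (FreeAbelianGroup.of a))

/-- The relations of mod `p` Milnor K-theory, written for the nonzero elements of a commutative
ring `R`: the third one is the Steinberg relation for the fractions `x / z` and `y / z`. -/
inductive KRel (p : ℕ) (R : Type*) [CommRing R] : FreeAlgebra ℤ R → FreeAlgebra ℤ R → Prop
  | char : KRel p R (p : FreeAlgebra ℤ R) 0
  | zero : KRel p R (FreeAlgebra.ι ℤ 0) 0
  | mul (x y : R) (hx : x ≠ 0) (hy : y ≠ 0) :
      KRel p R (FreeAlgebra.ι ℤ (x * y)) (FreeAlgebra.ι ℤ x + FreeAlgebra.ι ℤ y)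
  | add (x y : R) (hx : x ≠ 0) (hy : y ≠ 0) (hz : x + y ≠ 0) :
      KRel p R ((FreeAlgebra.ι ℤ x - FreeAlgebra.ι ℤ (x + y)) *
        (FreeAlgebra.ι ℤ y - FreeAlgebra.ι ℤ (x + y))) 0

/-- The mod `p` Milnor K-ring of (the fraction field of) a domain `R`. -/
def KM (p : ℕ) (R : Type*) [CommRing R] : Type _ := RingQuot (KRel p R)

noncomputable instance (p : ℕ) (R : Type*) [CommRing R] : Ring (KM p R) :=
  inferInstanceAs (Ring (RingQuot (KRel p R)))

namespace KM

noncomputable section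

section Basic

variable {p : ℕ} {R : Type*} [CommRing R]

/-- The quotient map from the free ring. -/
def mk : FreeAlgebra ℤ R →+* KM p R := RingQuot.mkRingHom (KRel p R)

theorem mk_surjective : Function.Surjective (mk (p := p) (R := R)) :=
  RingQuot.mkRingHom_surjective _

/-- The degree one symbol `{x}`. -/
def l (x : R) : KM p R := mk (FreeAlgebra.ι ℤ x)

theorem mk_ι (x : R) : mk (p := p) (FreeAlgebra.ι ℤ x) = l x := rfl

theorem mk_rel {a b : FreeAlgebra ℤ R} (h : KRel p R a b) : mk (p := p) a = mk b :=
  RingQuot.mkRingHom_rel h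

theorem natCast_eq_zero : (p : KM p R) = 0 := by
  simpa using mk_rel (KRel.char (p := p) (R := R))

theorem l_zero : l (p := p) (0 : R) = 0 := by
  simpa [mk_ι] using mk_rel (KRel.zero (p := p) (R := R))

theorem l_mul {x y : R} (hx : x ≠ 0) (hy : y ≠ 0) : l (p := p) (x * y) = l x + l y := by
  simpa [mk_ι] using mk_rel (KRel.mul (p := p) x y hx hy)

theorem l_steinberg {x y : R} (hx : x ≠ 0) (hy : y ≠ 0) (hz : x + y ≠ 0) :
    (l (p := p) x - l (x + y)) * (l y - l (x + y)) = 0 := by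
  simpa [mk_ι] using mk_rel (KRel.add (p := p) x y hx hy hz)

@[elab_as_elim]
theorem induction {P : KM p R → Prop} (hl : ∀ x, x ≠ 0 → P (l x)) (hint : ∀ n : ℤ, P n)
    (hadd : ∀ a b, P a → P b → P (a + b)) (hmul : ∀ a b, P a → P b → P (a * b))
    (z : KM p R) : P z := by
  obtain ⟨z, rfl⟩ := mk_surjective z
  induction z using FreeAlgebra.induction with
  | grade0 r => simpa using hint r
  | grade1 x =>
    by_cases hx : x = 0
    · rw [hx, mk_ι, l_zero]; simpa using hint 0
    · exact hl x hx
  | mul a b ha hb => rw [map_mul]; exact hmul _ _ ha hb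
  | add a b ha hb => rw [map_add]; exact hadd _ _ ha hb

/-- The universal property of the K-ring. -/
theorem exists_lift {A : Type*} [Ring A] (f : R → A) (hp : (p : A) = 0) (h0 : f 0 = 0)
    (hmul : ∀ x y, x ≠ 0 → y ≠ 0 → f (x * y) = f x + f y)
    (hst : ∀ x y, x ≠ 0 → y ≠ 0 → x + y ≠ 0 → (f x - f (x + y)) * (f y - f (x + y)) = 0) :
    ∃ g : KM p R →+* A, ∀ x, g (l x) = f x := by
  let F : FreeAlgebra ℤ R →+* A := (FreeAlgebra.lift ℤ f : FreeAlgebra ℤ R →ₐ[ℤ] A)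
  have hF : ∀ x, F (FreeAlgebra.ι ℤ x) = f x := fun x => FreeAlgebra.lift_ι_apply f x
  have key : ∀ ⦃a b : FreeAlgebra ℤ R⦄, KRel p R a b → F a = F b := by
    intro a b h
    cases h with
    | char => simpa using hp
    | zero => simpa [hF] using h0
    | mul x y hx hy => simpa [hF] using hmul x y hx hy
    | add x y hx hy hz => simpa [hF] using hst x y hx hy hz
  exact ⟨RingQuot.lift ⟨F, key⟩, fun x => by
    rw [← hF]; exact RingQuot.lift_mkRingHom_apply F key _⟩

/-- An additive map on the free ring which kills the relations descends to the K-ring. -/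
theorem exists_desc {G : Type*} [AddCommGroup G] (τ : FreeAlgebra ℤ R →+ G)
    (h : ∀ a b, KRel p R a b → ∀ x y, τ (x * (a - b) * y) = 0) :
    ∃ T : KM p R →+ G, ∀ z, T (mk z) = τ z := by
  let c : RingCon (FreeAlgebra ℤ R) :=
    { r := fun a b => ∀ x y, τ (x * (a - b) * y) = 0
      iseqv := ⟨fun a x y => by simp, fun {a b} hab x y => by
          rw [← neg_sub, mul_neg, neg_mul, map_neg, hab, neg_zero],
        fun {a b d} hab hbd x y => by
          rw [← sub_add_sub_cancel a b d, mul_add, add_mul, map_add, hab, hbd, add_zero]⟩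
      add' := fun {a b d e} hab hde x y => by
        rw [add_sub_add_comm, mul_add, add_mul, map_add, hab, hde, add_zero]
      mul' := fun {a b d e} hab hde x y => by
        have : x * (a * d - b * e) * y = x * (a - b) * (d * y) + (x * b) * (d - e) * y := by
          noncomm_ring
        rw [this, map_add, hab, hde, add_zero] }
  have hker : ∀ z : FreeAlgebra ℤ R, mk (p := p) z = 0 → τ z = 0 := by
    intro z hz
    have key : ∀ ⦃a b : FreeAlgebra ℤ R⦄, KRel p R a b → c.mk' a = c.mk' b :=
      fun a b hab => (RingCon.eq c).2 (h a b hab)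
    have h1 : (RingQuot.lift ⟨c.mk', key⟩) (RingQuot.mkRingHom (KRel p R) z) = c.mk' z :=
      RingQuot.lift_mkRingHom_apply c.mk' key z
    have h2 : RingQuot.mkRingHom (KRel p R) z = 0 := hz
    rw [h2, map_zero] at h1
    have h3 : c z 0 := (RingCon.eq c).1 (by rw [RingCon.coe_zero]; exact h1.symm)
    simpa using h3 1 1
  refine ⟨((mk (p := p) (R := R)).toAddMonoidHom.liftOfSurjective mk_surjective) ⟨τ, ?_⟩, ?_⟩
  · intro z hz
    exact hker z hz
  · intro z
    exact AddMonoidHom.liftOfRightInverse_comp_apply _ _ _ ⟨τ, _⟩ z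

/-- Functoriality of the K-ring for injective ring homomorphisms. -/
theorem exists_map {R' : Type*} [CommRing R'] (f : R →+* R') (hf : Function.Injective f) :
    ∃ g : KM p R →+* KM p R', ∀ x, g (l x) = l (f x) := by
  have hne : ∀ x, x ≠ 0 → f x ≠ 0 := fun x hx => (map_ne_zero_iff f hf).2 hx
  refine exists_lift (fun x => l (f x)) natCast_eq_zero (by simp [l_zero]) ?_ ?_
  · intro x y hx hy
    simp only [map_mul]
    exact l_mul (hne x hx) (hne y hy)
  · intro x y hx hy hz
    simp only [map_add]
    exact l_steinberg (hne x hx) (hne y hy) (by rw [← map_add]; exact hne _ hz)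

/-- The homomorphism of K-rings induced by an injective ring homomorphism. -/
def map {R' : Type*} [CommRing R'] (f : R →+* R') (hf : Function.Injective f) :
    KM p R →+* KM p R' := (exists_map f hf).choose

@[simp] theorem map_l {R' : Type*} [CommRing R'] (f : R →+* R') (hf : Function.Injective f)
    (x : R) : map (p := p) f hf (l x) = l (f x) := (exists_map f hf).choose_spec x

end Basic

section Domain

variable {p : ℕ} {R : Type*} [CommRing R] [IsDomain R]

@[simp] theorem l_one : l (p := p) (1 : R) = 0 := by
  have := l_mul (p := p) (one_ne_zero (α := R)) one_ne_zero
  simpa using this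

theorem l_neg_one_add_self : l (p := p) (-1 : R) + l (-1) = 0 := by
  have h : (-1 : R) ≠ 0 := neg_ne_zero.2 one_ne_zero
  rw [← l_mul h h]; simp

theorem l_neg {x : R} (hx : x ≠ 0) : l (p := p) (-x) = l x + l (-1) := by
  rw [← mul_neg_one, l_mul hx (neg_ne_zero.2 one_ne_zero)]

theorem l_pow {x : R} (hx : x ≠ 0) (n : ℕ) : l (p := p) (x ^ n) = (n : KM p R) * l x := by
  induction n with
  | zero => simp
  | succ n ih => rw [pow_succ, l_mul (pow_ne_zero _ hx) hx, ih, Nat.cast_succ, add_mul, one_mul]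

theorem l_sub_mul_self {x z : R} (hx : x ≠ 0) (hz : z ≠ 0) :
    (l (p := p) x - l z) * (l x - l z + l (-1)) = 0 := by
  by_cases hxz : x = z
  · simp [hxz]
  have hy : z - x ≠ 0 := sub_ne_zero.2 (Ne.symm hxz)
  have h1 := l_steinberg (p := p) hx hy (by simpa using hz)
  have h2 := l_steinberg (p := p) hz (neg_ne_zero.2 hy) (by simpa using hx)
  have e1 : x + (z - x) = z := by ring
  have e2 : z + -(z - x) = x := by ring
  rw [e1] at h1
  rw [e2, l_neg hy] at h2
  calc _ = (l x - l z) * (l (z - x) - l z) + (l z - l x) * (l (z - x) + l (-1) - l x)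
        + (l (p := p) x - l z) * (l (-1) + l (-1)) := by noncomm_ring
    _ = 0 := by rw [h1, h2, l_neg_one_add_self]; simp

theorem l_mul_self {x : R} (hx : x ≠ 0) : l (p := p) x * l x = l x * l (-1) := by
  have h := l_sub_mul_self (p := p) hx one_ne_zero
  have h2 := congrArg (l (p := p) x * ·) (l_neg_one_add_self (p := p) (R := R))
  simp only [l_one, sub_zero, mul_add, mul_zero] at h h2
  exact (eq_neg_of_add_eq_zero_left h).trans (eq_neg_of_add_eq_zero_left h2).symm

theorem l_mul_l_neg {x : R} (hx : x ≠ 0) : l (p := p) x * l (-x) = 0 := by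
  have h := l_sub_mul_self (p := p) hx one_ne_zero
  rw [l_neg hx]
  simpa using h

theorem l_anticomm (x y : R) : l (p := p) x * l y = -(l y * l x) := by
  by_cases hx : x = 0
  · simp [hx, l_zero]
  by_cases hy : y = 0
  · simp [hy, l_zero]
  have h := l_mul_l_neg (p := p) (mul_ne_zero hx hy)
  have h1 := l_mul_l_neg (p := p) hx
  have h2 := l_mul_l_neg (p := p) hy
  rw [l_neg (mul_ne_zero hx hy), l_mul hx hy] at h
  rw [l_neg hx] at h1
  rw [l_neg hy] at h2
  refine eq_neg_of_add_eq_zero_left ?_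
  calc _ = (l x + l y) * (l x + l y + l (-1)) - l x * (l x + l (-1))
      - l (p := p) y * (l y + l (-1)) := by noncomm_ring
    _ = 0 := by rw [h, h1, h2]; simp

end Domain

end

end KM

/-- A multiplicative order-and-leading-coefficient datum on a domain `R` with residue ring `k`,
as given by a discrete valuation with a chosen uniformizer. -/
structure Place (R k : Type*) [CommRing R] [CommRing k] where
  /-- the order -/
  v : R → ℤ
  /-- the leading coefficient -/
  u : R → k
  v_zero : v 0 = 0
  u_zero : u 0 = 0
  u_ne_zero : ∀ x, x ≠ 0 → u x ≠ 0
  v_mul : ∀ x y, x ≠ 0 → y ≠ 0 → v (x * y) = v x + v y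
  u_mul : ∀ x y, x ≠ 0 → y ≠ 0 → u (x * y) = u x * u y
  add_of_lt : ∀ x y, x ≠ 0 → y ≠ 0 → x + y ≠ 0 → v x < v y → v (x + y) = v x ∧ u (x + y) = u x
  add_of_eq : ∀ x y, x ≠ 0 → y ≠ 0 → x + y ≠ 0 → v x = v y →
    (v (x + y) = v x ∧ u (x + y) = u x + u y) ∨ u x + u y = 0

namespace Place

noncomputable section

open KM Matrix

variable {p : ℕ} {R k : Type*} [CommRing R] [CommRing k]

/-- The matrix by which a symbol with leading coefficient symbol `A` and order `v` acts. -/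
def tameMatrix (A : KM p k) (v : ℤ) : Matrix (Fin 2) (Fin 2) (KM p k) :=
  !![A, 0; (v : KM p k), -A + (v : KM p k) * l (-1)]

theorem tameMatrix_add (A B : KM p k) (v w : ℤ) :
    tameMatrix (A + B) (v + w) = tameMatrix A v + tameMatrix B w := by
  ext i j
  fin_cases i <;> fin_cases j <;> simp [tameMatrix]
  noncomm_ring

theorem tameMatrix_sub (A B : KM p k) (v w : ℤ) :
    tameMatrix (A - B) (v - w) = tameMatrix A v - tameMatrix B w := by
  ext i j
  fin_cases i <;> fin_cases j <;> simp [tameMatrix]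
  noncomm_ring

theorem tameMatrix_zero : tameMatrix (0 : KM p k) 0 = 0 := by
  ext i j
  fin_cases i <;> fin_cases j <;> simp [tameMatrix]

theorem tameMatrix_mul_zero {A B : KM p k} (h : A * B = 0) :
    tameMatrix A 0 * tameMatrix B 0 = 0 := by
  ext i j
  fin_cases i <;> fin_cases j <;> simp [tameMatrix, Matrix.mul_apply, Fin.sum_univ_two, h]

variable [IsDomain k]

theorem tameMatrix_mul_neg (A : KM p k) (n : ℤ) (h1 : A * (A + l (-1)) = 0)
    (h2 : A * l (-1) = -(l (-1) * A)) :
    tameMatrix A n * tameMatrix (A + l (-1)) n = 0 := by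
  have h3 := l_neg_one_add_self (p := p) (R := k)
  set ε : KM p k := l (-1) with hε
  have hc : ∀ z : KM p k, z * (n : KM p k) = n * z := fun z => (Int.cast_commute n z).eq.symm
  have h4 : ((n : KM p k) + n * n) * ε = 0 := by
    obtain ⟨m, hm⟩ : Even (n + n * n) := by
      have := Int.even_mul_succ_self n
      rwa [show n * (n + 1) = n + n * n by ring] at this
    rw [← Int.cast_mul, ← Int.cast_add, hm, Int.cast_add, add_mul, ← mul_add, h3, mul_zero]
  have e1 : (n : KM p k) * (A + ε) + (-A + n * ε) * n = 0 := by
    rw [add_mul, neg_mul, hc A, mul_assoc, hc ε]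
    calc _ = ((n : KM p k) + n * n) * ε := by noncomm_ring
      _ = 0 := h4
  have e2 : (-A + n * ε) * (-(A + ε) + n * ε) = 0 := by
    have hA : A * A = ε * A := by
      rw [mul_add] at h1
      rw [eq_neg_of_add_eq_zero_left h1, h2, neg_neg]
    calc _ = A * (A + ε) - (A * n) * ε + n * (-(ε * A) - ε * ε) + n * ((ε * n) * ε) := by
          noncomm_ring
      _ = -(n * (A * ε) + n * (ε * A)) + (-n * ε + n * n * ε) * ε := by
          rw [h1, hc A, hc ε]; noncomm_ring
      _ = -(n * (A * ε) + n * (ε * A)) + ((n + n * n) * ε - n * (ε + ε)) * ε := by noncomm_ring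
      _ = 0 := by rw [h4, h3, h2]; simp
  ext i j
  fin_cases i <;> fin_cases j <;>
    simp [tameMatrix, Matrix.mul_apply, Fin.sum_univ_two, h1, e1, ← hε]
  simpa using e2

variable (P : Place R k)

theorem exists_tame : ∃ g : KM p R →+* Matrix (Fin 2) (Fin 2) (KM p k),
    ∀ x, g (l x) = tameMatrix (l (P.u x)) (P.v x) := by
  refine exists_lift (fun x => tameMatrix (l (P.u x)) (P.v x)) ?_ ?_ ?_ ?_
  · have h : (p : Matrix (Fin 2) (Fin 2) (KM p k)) = Matrix.diagonal fun _ => (p : KM p k) :=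
      (Matrix.diagonal_natCast' p).symm
    rw [h, natCast_eq_zero, Matrix.diagonal_zero]
  · simp [P.v_zero, P.u_zero, l_zero, tameMatrix_zero]
  · intro x y hx hy
    rw [P.v_mul x y hx hy, P.u_mul x y hx hy, l_mul (P.u_ne_zero x hx) (P.u_ne_zero y hy),
      tameMatrix_add]
  · intro x y hx hy hz
    rcases lt_trichotomy (P.v x) (P.v y) with h | h | h
    · obtain ⟨h1, h2⟩ := P.add_of_lt x y hx hy hz h
      rw [h1, h2, sub_self, zero_mul]
    · rcases P.add_of_eq x y hx hy hz h with ⟨h1, h2⟩ | h1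
      · have h3 := P.u_ne_zero _ hz
        rw [h2] at h3
        rw [h1, h2, ← h, ← tameMatrix_sub, ← tameMatrix_sub, sub_self]
        exact tameMatrix_mul_zero (l_steinberg (P.u_ne_zero x hx) (P.u_ne_zero y hy) h3)
      · rw [eq_neg_of_add_eq_zero_right h1, ← h, l_neg (P.u_ne_zero x hx), ← tameMatrix_sub,
          ← tameMatrix_sub, add_sub_right_comm]
        refine tameMatrix_mul_neg _ _ (l_sub_mul_self (P.u_ne_zero x hx) (P.u_ne_zero _ hz)) ?_
        rw [sub_mul, mul_sub, l_anticomm, l_anticomm (P.u (x + y))]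
        noncomm_ring
    · obtain ⟨h1, h2⟩ := P.add_of_lt y x hy hx (by rwa [add_comm]) h
      rw [add_comm x y, h1, h2, sub_self, mul_zero]

/-- The tame symbol of a place, packaged as a representation. -/
def tame : KM p R →+* Matrix (Fin 2) (Fin 2) (KM p k) := P.exists_tame.choose

theorem tame_l (x : R) : P.tame (l (p := p) x) = tameMatrix (l (P.u x)) (P.v x) :=
  P.exists_tame.choose_spec x

theorem tame_upper (z : KM p R) : P.tame z 0 1 = 0 := by
  induction z using KM.induction with
  | hl x hx => simp [tame_l, tameMatrix]
  | hint n =>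
    rw [map_intCast, ← Matrix.diagonal_intCast, Matrix.diagonal_apply_ne _ (by decide)]
  | hadd a b ha hb => simp [ha, hb]
  | hmul a b ha hb => simp [Matrix.mul_apply, Fin.sum_univ_two, ha, hb]

/-- The specialization homomorphism of a place. -/
def sp : KM p R →+* KM p k where
  toFun z := P.tame z 0 0
  map_one' := by simp
  map_mul' a b := by simp [Matrix.mul_apply, Fin.sum_univ_two, tame_upper]
  map_zero' := by simp
  map_add' a b := by simp

/-- The residue homomorphism of a place. -/
def res : KM p R →+ KM p k where
  toFun z := P.tame z 1 0
  map_zero' := by simp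
  map_add' a b := by simp

theorem sp_l (x : R) : P.sp (l (p := p) x) = l (P.u x) := by
  simp [sp, tame_l, tameMatrix]

theorem res_one : P.res (1 : KM p R) = 0 := by
  simp [res]

theorem res_intCast (n : ℤ) : P.res (n : KM p R) = 0 := by
  simp only [res, AddMonoidHom.coe_mk, ZeroHom.coe_mk, map_intCast]
  rw [← Matrix.diagonal_intCast, Matrix.diagonal_apply_ne _ (by decide)]

theorem res_l (x : R) : P.res (l (p := p) x) = P.v x := by
  simp [res, tame_l, tameMatrix]

theorem res_mul (z w : KM p R) :
    P.res (z * w) = P.res z * P.sp w + P.tame z 1 1 * P.res w := by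
  simp [res, sp, Matrix.mul_apply, Fin.sum_univ_two]

theorem res_l_mul (x : R) (w : KM p R) :
    P.res (l x * w) =
    (P.v x : KM p k) * P.sp w + (-l (P.u x) + (P.v x : KM p k) * l (-1)) * P.res w := by
  rw [res_mul, res_l, tame_l]
  simp [tameMatrix]

theorem res_eq_zero_of_mem {S : Set R} (hS : ∀ x ∈ S, P.v x = 0) {z : KM p R}
    (hz : z ∈ Subring.closure (l '' S)) : P.res z = 0 := by
  induction hz using Subring.closure_induction with
  | mem x hx =>
    obtain ⟨y, hy, rfl⟩ := hx
    rw [res_l, hS y hy, Int.cast_zero]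
  | zero => simp
  | one => exact P.res_one
  | add a b _ _ ha hb => simp [ha, hb]
  | neg a _ ha => simp [ha]
  | mul a b _ _ ha hb => simp [res_mul, ha, hb]

end

end Place

namespace Place

noncomputable section

variable {K : Type*} [Field K]

open Classical in
/-- The multiplicity of a polynomial at an irreducible polynomial. -/
def orderAt (w f : Polynomial K) : ℤ := if f = 0 then 0 else (multiplicity w f : ℤ)

/-- The leading coefficient at an irreducible polynomial. -/
def leadAt (w f : Polynomial K) : AdjoinRoot w := AdjoinRoot.mk w (f / w ^ multiplicity w f)

theorem orderAt_leadAt_pow_mul {w f : Polynomial K} (hw : Irreducible w) (n : ℕ)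
    (hf : ¬ w ∣ f) : orderAt w (w ^ n * f) = n ∧ leadAt w (w ^ n * f) = AdjoinRoot.mk w f := by
  have h0 : w ^ n ≠ 0 := pow_ne_zero _ hw.ne_zero
  have hf0 : f ≠ 0 := fun h => hf (h ▸ dvd_zero w)
  have h : multiplicity w (w ^ n * f) = n :=
    multiplicity_eq_of_dvd_of_not_dvd (dvd_mul_right _ _) (by
      rw [pow_succ]; exact fun h => hf ((mul_dvd_mul_iff_left h0).1 h))
  constructor
  · rw [orderAt, if_neg (mul_ne_zero h0 hf0), h]
  · rw [leadAt, h, mul_div_cancel_left₀ _ h0]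

theorem orderAt_leadAt_of_not_dvd {w f : Polynomial K} (hw : Irreducible w) (hf : ¬ w ∣ f) :
    orderAt w f = 0 ∧ leadAt w f = AdjoinRoot.mk w f := by
  simpa using orderAt_leadAt_pow_mul hw 0 hf

theorem exists_eq_pow_mul_not_dvd {w f : Polynomial K} (hw : Irreducible w) (hf : f ≠ 0) :
    ∃ (n : ℕ) (g : Polynomial K), ¬ w ∣ g ∧ f = w ^ n * g := by
  obtain ⟨g, h1, h2⟩ :=
    (FiniteMultiplicity.of_not_isUnit hw.not_isUnit hf).exists_eq_pow_mul_and_not_dvd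
  exact ⟨_, g, h2, h1⟩

/-- The place of the affine line attached to an irreducible polynomial. -/
def finite (w : Polynomial K) (hw : Irreducible w) : Place (Polynomial K) (AdjoinRoot w) where
  v := orderAt w
  u := leadAt w
  v_zero := by simp [orderAt]
  u_zero := by simp [leadAt]
  u_ne_zero f hf := by
    obtain ⟨n, g, hg, rfl⟩ := exists_eq_pow_mul_not_dvd hw hf
    rwa [(orderAt_leadAt_pow_mul hw n hg).2, Ne, AdjoinRoot.mk_eq_zero]
  v_mul f g hf hg := by
    obtain ⟨n, f', hf', rfl⟩ := exists_eq_pow_mul_not_dvd hw hf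
    obtain ⟨m, g', hg', rfl⟩ := exists_eq_pow_mul_not_dvd hw hg
    have h : ¬ w ∣ f' * g' := fun h => (hw.prime.dvd_or_dvd h).elim hf' hg'
    rw [mul_mul_mul_comm, ← pow_add, (orderAt_leadAt_pow_mul hw _ h).1,
      (orderAt_leadAt_pow_mul hw _ hf').1, (orderAt_leadAt_pow_mul hw _ hg').1, Nat.cast_add]
  u_mul f g hf hg := by
    obtain ⟨n, f', hf', rfl⟩ := exists_eq_pow_mul_not_dvd hw hf
    obtain ⟨m, g', hg', rfl⟩ := exists_eq_pow_mul_not_dvd hw hg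
    have h : ¬ w ∣ f' * g' := fun h => (hw.prime.dvd_or_dvd h).elim hf' hg'
    rw [mul_mul_mul_comm, ← pow_add, (orderAt_leadAt_pow_mul hw _ h).2,
      (orderAt_leadAt_pow_mul hw _ hf').2, (orderAt_leadAt_pow_mul hw _ hg').2, map_mul]
  add_of_lt f g hf hg hfg hlt := by
    obtain ⟨n, f', hf', rfl⟩ := exists_eq_pow_mul_not_dvd hw hf
    obtain ⟨m, g', hg', rfl⟩ := exists_eq_pow_mul_not_dvd hw hg
    rw [(orderAt_leadAt_pow_mul hw _ hf').1, (orderAt_leadAt_pow_mul hw _ hg').1,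
      Nat.cast_lt] at hlt
    obtain ⟨k, rfl⟩ := Nat.exists_eq_add_of_lt hlt
    have e : w ^ n * f' + w ^ (n + k + 1) * g' = w ^ n * (f' + w * (w ^ k * g')) := by ring
    have h : ¬ w ∣ f' + w * (w ^ k * g') := by
      rwa [dvd_add_left (dvd_mul_right _ _)]
    rw [e, (orderAt_leadAt_pow_mul hw _ h).1, (orderAt_leadAt_pow_mul hw _ h).2,
      (orderAt_leadAt_pow_mul hw _ hf').1, (orderAt_leadAt_pow_mul hw _ hf').2]
    simp
  add_of_eq f g hf hg hfg heq := by
    obtain ⟨n, f', hf', rfl⟩ := exists_eq_pow_mul_not_dvd hw hf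
    obtain ⟨m, g', hg', rfl⟩ := exists_eq_pow_mul_not_dvd hw hg
    rw [(orderAt_leadAt_pow_mul hw _ hf').1, (orderAt_leadAt_pow_mul hw _ hg').1,
      Nat.cast_inj] at heq
    subst heq
    rw [(orderAt_leadAt_pow_mul hw _ hf').2, (orderAt_leadAt_pow_mul hw _ hg').2,
      (orderAt_leadAt_pow_mul hw _ hf').1, ← mul_add, ← map_add]
    by_cases h : w ∣ f' + g'
    · exact Or.inr (AdjoinRoot.mk_eq_zero.2 h)
    · exact Or.inl ⟨(orderAt_leadAt_pow_mul hw _ h).1, (orderAt_leadAt_pow_mul hw _ h).2⟩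

theorem finite_v_u_of_not_dvd {w f : Polynomial K} (hw : Irreducible w) (hf : ¬ w ∣ f) :
    (finite w hw).v f = 0 ∧ (finite w hw).u f = AdjoinRoot.mk w f :=
  orderAt_leadAt_of_not_dvd hw hf

theorem finite_v_u_self {w : Polynomial K} (hw : Irreducible w) :
    (finite w hw).v w = 1 ∧ (finite w hw).u w = 1 := by
  have := orderAt_leadAt_pow_mul hw 1 (f := 1) (fun h => hw.not_isUnit (isUnit_of_dvd_one h))
  rw [pow_one, mul_one, map_one, Nat.cast_one] at this
  exact this

/-- The place at infinity of the projective line. -/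
def infinity (K : Type*) [Field K] : Place (Polynomial K) K where
  v f := -(f.natDegree : ℤ)
  u f := f.leadingCoeff
  v_zero := by simp
  u_zero := by simp
  u_ne_zero f hf := Polynomial.leadingCoeff_ne_zero.2 hf
  v_mul f g hf hg := by rw [Polynomial.natDegree_mul hf hg]; push_cast; ring
  u_mul f g _ _ := Polynomial.leadingCoeff_mul f g
  add_of_lt f g hf hg hfg hlt := by
    have h : g.natDegree < f.natDegree := by omega
    exact ⟨by rw [Polynomial.natDegree_add_eq_left_of_natDegree_lt h],
      Polynomial.leadingCoeff_add_of_degree_lt' (Polynomial.degree_lt_degree h)⟩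
  add_of_eq f g hf hg hfg heq := by
    have h : f.natDegree = g.natDegree := by omega
    by_cases hc : f.leadingCoeff + g.leadingCoeff = 0
    · exact Or.inr hc
    · have hd : f.degree = g.degree := by
        rw [Polynomial.degree_eq_natDegree hf, Polynomial.degree_eq_natDegree hg, h]
      refine Or.inl ⟨?_, Polynomial.leadingCoeff_add_of_degree_eq hd hc⟩
      have h1 : (f + g).degree = f.degree := by
        rw [Polynomial.degree_add_eq_of_leadingCoeff_add_ne_zero hc, hd, max_self]
      rw [Polynomial.natDegree_eq_of_degree_eq h1]

end

end Place

namespace KM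

@[simp] theorem map_id_apply {p : ℕ} {R : Type*} [CommRing R] (z : KM p R) :
    map (RingHom.id R) Function.injective_id z = z := by
  induction z using KM.induction with
  | hl x hx => simp
  | hint n => simp
  | hadd a b ha hb => rw [map_add, ha, hb]
  | hmul a b ha hb => rw [map_mul, ha, hb]

end KM

namespace Place

open KM

section Constants

variable {p : ℕ} {L R k : Type*} [CommRing L] [CommRing R] [CommRing k] [IsDomain k]
  (P : Place R k) {c : L →+* R} (hc : Function.Injective c) {i : L →+* k}

theorem sp_map (hi : Function.Injective i) (hu : ∀ x, P.u (c x) = i x) (r : KM p L) :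
    P.sp (map c hc r) = map i hi r := by
  induction r using KM.induction with
  | hl x hx => rw [map_l, map_l, sp_l, hu]
  | hint n => simp
  | hadd a b ha hb => rw [map_add, map_add, map_add, ha, hb]
  | hmul a b ha hb => rw [map_mul, map_mul, map_mul, ha, hb]

theorem res_map (hv : ∀ x, P.v (c x) = 0) (r : KM p L) : P.res (map c hc r) = 0 := by
  induction r using KM.induction with
  | hl x hx => rw [map_l, res_l, hv, Int.cast_zero]
  | hint n => rw [map_intCast, res_intCast]
  | hadd a b ha hb => rw [map_add, map_add, ha, hb, add_zero]
  | hmul a b ha hb => rw [map_mul, res_mul, ha, hb, zero_mul, mul_zero, add_zero]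

theorem res_mul_map (hi : Function.Injective i) (hu : ∀ x, P.u (c x) = i x)
    (hv : ∀ x, P.v (c x) = 0) (z : KM p R) (r : KM p L) :
    P.res (z * map c hc r) = P.res z * map i hi r := by
  rw [res_mul, P.res_map hc hv, P.sp_map hc hi hu, mul_zero, add_zero]

end Constants

end Place

/-- The closed points of the affine line over a field. -/
def ClosedPoint (K : Type*) [Field K] := {w : Polynomial K // w.Monic ∧ Irreducible w}

namespace ClosedPoint

noncomputable section

open KM

variable {p : ℕ} {K : Type*} [Field K]

instance (w : ClosedPoint K) : Fact (Irreducible w.1) := ⟨w.2.2⟩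

/-- The residue field of a closed point. -/
abbrev residueField (w : ClosedPoint K) : Type _ := AdjoinRoot w.1

/-- The place attached to a closed point. -/
def place (w : ClosedPoint K) : Place (Polynomial K) w.residueField := Place.finite w.1 w.2.2

theorem natDegree_pos (w : ClosedPoint K) : 0 < w.1.natDegree := w.2.2.natDegree_pos

theorem not_dvd_of_natDegree_lt (w : ClosedPoint K) {f : Polynomial K} (hf : f ≠ 0)
    (h : f.natDegree < w.1.natDegree) : ¬ w.1 ∣ f :=
  fun hd => absurd (Polynomial.natDegree_le_of_dvd hd hf) (not_le.2 h)

theorem v_of_natDegree_lt (w : ClosedPoint K) {f : Polynomial K}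
    (h : f.natDegree < w.1.natDegree) : w.place.v f = 0 := by
  by_cases hf : f = 0
  · rw [hf, w.place.v_zero]
  · exact (Place.finite_v_u_of_not_dvd w.2.2 (w.not_dvd_of_natDegree_lt hf h)).1

theorem u_of_natDegree_lt (w : ClosedPoint K) {f : Polynomial K}
    (h : f.natDegree < w.1.natDegree) : w.place.u f = AdjoinRoot.mk w.1 f := by
  by_cases hf : f = 0
  · rw [hf, w.place.u_zero, map_zero]
  · exact (Place.finite_v_u_of_not_dvd w.2.2 (w.not_dvd_of_natDegree_lt hf h)).2

theorem not_dvd_of_ne {w π : ClosedPoint K} (h : w ≠ π) : ¬ w.1 ∣ π.1 := fun hd =>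
  h (Subtype.ext (Polynomial.eq_of_monic_of_associated w.2.1 π.2.1
    ((w.2.2.dvd_irreducible_iff_associated π.2.2).1 hd)))

/-- Extension of scalars of K-rings to the residue field. -/
abbrev ext (w : ClosedPoint K) : KM p K →+* KM p w.residueField :=
  map (AdjoinRoot.of w.1) (AdjoinRoot.of w.1).injective

/-- Extension of scalars of K-rings to the affine line. -/
abbrev cst : KM p K →+* KM p (Polynomial K) := map Polynomial.C Polynomial.C_injective

theorem res_mul_cst (w : ClosedPoint K) (z : KM p (Polynomial K)) (r : KM p K) :
    w.place.res (z * cst r) = w.place.res z * w.ext r := by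
  have h : ∀ x : K, (Polynomial.C x).natDegree < w.1.natDegree := fun x => by
    simpa using w.natDegree_pos
  exact w.place.res_mul_map _ _ (fun x => w.u_of_natDegree_lt (h x))
    (fun x => w.v_of_natDegree_lt (h x)) z r

theorem res_infinity_mul_cst (z : KM p (Polynomial K)) (r : KM p K) :
    (Place.infinity K).res (z * cst r) = (Place.infinity K).res z * r := by
  have := (Place.infinity K).res_mul_map (p := p) (c := Polynomial.C) (i := RingHom.id K)
    Polynomial.C_injective Function.injective_id
    (fun x => by simp [Place.infinity]) (fun x => by simp [Place.infinity]) z r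
  rwa [map_id_apply] at this

theorem finite_res_ne_zero (z : KM p (Polynomial K)) :
    {w : ClosedPoint K | w.place.res z ≠ 0}.Finite := by
  induction z using KM.induction with
  | hl f hf =>
    have key : ∀ w : ClosedPoint K, w.place.res (l (p := p) f) ≠ 0 → w.1 ∣ f := fun w hw => by
      by_contra h
      refine hw ?_
      rw [Place.res_l, place, (Place.finite_v_u_of_not_dvd w.2.2 h).1, Int.cast_zero]
    classical
    refine Set.Finite.subset (Set.Finite.preimage Subtype.val_injective.injOn
      (UniqueFactorizationMonoid.normalizedFactors f).toFinset.finite_toSet) fun w hw => ?_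
    exact Multiset.mem_toFinset.2
      ((Polynomial.mem_normalizedFactors_iff hf).2 ⟨w.2.2, w.2.1, key w hw⟩)
  | hint n => simp [Place.res_intCast]
  | hadd a b ha hb =>
    refine (ha.union hb).subset fun w hw => ?_
    by_contra h
    simp only [Set.mem_union, Set.mem_ofPred_eq, not_or, not_not] at h
    exact hw (by rw [map_add, h.1, h.2, add_zero])
  | hmul a b ha hb =>
    refine (ha.union hb).subset fun w hw => ?_
    by_contra h
    simp only [Set.mem_union, Set.mem_ofPred_eq, not_or, not_not] at h
    exact hw (by rw [Place.res_mul, h.1, h.2, zero_mul, mul_zero, add_zero])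

theorem finite_support_res (T : ∀ w : ClosedPoint K, KM p w.residueField →+ KM p K)
    (z : KM p (Polynomial K)) :
    (Function.support fun w : ClosedPoint K => T w (w.place.res z)).Finite :=
  (finite_res_ne_zero z).subset fun w hw h => hw (by simp only [h, map_zero])

/-- The sum over all closed points of the projective line of the transfers of the residues, up
to sign. -/
def defect (T : ∀ w : ClosedPoint K, KM p w.residueField →+ KM p K) :
    KM p (Polynomial K) →+ KM p K where
  toFun z := (Place.infinity K).res z + ∑ᶠ w : ClosedPoint K, T w (w.place.res z)
  map_zero' := by simp
  map_add' a b := by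
    simp only [map_add]
    rw [finsum_add_distrib (finite_support_res T a) (finite_support_res T b)]
    abel

theorem defect_apply (T : ∀ w : ClosedPoint K, KM p w.residueField →+ KM p K)
    (z : KM p (Polynomial K)) :
    defect T z = (Place.infinity K).res z + ∑ᶠ w : ClosedPoint K, T w (w.place.res z) := rfl

/-- Right linearity (the projection formula) of a map on the K-ring of a residue field. -/
def IsLinear (w : ClosedPoint K) (T : KM p w.residueField →+ KM p K) : Prop :=
  ∀ z r, T (z * w.ext r) = T z * r

theorem defect_mul_cst {T : ∀ w : ClosedPoint K, KM p w.residueField →+ KM p K}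
    (hT : ∀ w, IsLinear w (T w)) (z : KM p (Polynomial K)) (r : KM p K) :
    defect T (z * cst r) = defect T z * r := by
  rw [defect_apply, defect_apply, res_infinity_mul_cst, add_mul,
    finsum_mul' _ _ (finite_support_res T z)]
  congr 1
  exact finsum_congr fun w => by rw [res_mul_cst, hT]

variable (p K) in
/-- The subring generated by the symbols of polynomials of bounded degree. -/
def degreeLE (d : ℕ) : Subring (KM p (Polynomial K)) :=
  Subring.closure (l '' {f | f.natDegree ≤ d})

theorem l_mem_degreeLE {d : ℕ} {f : Polynomial K} (h : f.natDegree ≤ d) :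
    l f ∈ degreeLE p K d := Subring.subset_closure ⟨f, h, rfl⟩

theorem res_of_mem_degreeLE {d : ℕ} {w : ClosedPoint K} (hw : d < w.1.natDegree)
    {s : KM p (Polynomial K)} (hs : s ∈ degreeLE p K d) : w.place.res s = 0 :=
  w.place.res_eq_zero_of_mem (fun _ hx => w.v_of_natDegree_lt (lt_of_le_of_lt hx hw)) hs

theorem exists_mul_comm {d : ℕ} {W : KM p (Polynomial K)} (hW : ∀ f, l f * W = -(W * l f))
    {s : KM p (Polynomial K)} (hs : s ∈ degreeLE p K d) :
    ∃ s' ∈ degreeLE p K d, s * W = W * s' := by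
  induction hs using Subring.closure_induction with
  | mem x hx =>
    obtain ⟨f, hf, rfl⟩ := hx
    exact ⟨-l f, neg_mem (l_mem_degreeLE hf), by rw [hW, mul_neg]⟩
  | zero => exact ⟨0, zero_mem _, by simp⟩
  | one => exact ⟨1, one_mem _, by simp⟩
  | add a b _ _ ha hb =>
    obtain ⟨a', ha', ea⟩ := ha
    obtain ⟨b', hb', eb⟩ := hb
    exact ⟨a' + b', add_mem ha' hb', by rw [add_mul, ea, eb, mul_add]⟩
  | neg a _ ha =>
    obtain ⟨a', ha', ea⟩ := ha
    exact ⟨-a', neg_mem ha', by rw [neg_mul, ea, mul_neg]⟩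
  | mul a b _ _ ha hb =>
    obtain ⟨a', ha', ea⟩ := ha
    obtain ⟨b', hb', eb⟩ := hb
    exact ⟨a' * b', mul_mem ha' hb', by rw [mul_assoc, eb, ← mul_assoc, ea, mul_assoc]⟩

theorem l_mul_mem_degreeLE {d : ℕ} {π a b c f : Polynomial K} (hπ : π ≠ 0)
    (ha : a ≠ 0) (hb : b ≠ 0) (hc : c ≠ 0) (had : a.natDegree ≤ d) (hbd : b.natDegree ≤ d)
    (hcd : c.natDegree ≤ d) (hπd : π.natDegree = d + 1) (h : a * b = π * f + c) :
    l π * (l c - (l a + l b)) ∈ degreeLE p K d := by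
  by_cases hf : f = 0
  · rw [hf, mul_zero, zero_add] at h
    rw [← h, l_mul ha hb, sub_self, mul_zero]
    exact zero_mem _
  have hfd : f.natDegree ≤ d := by
    have h1 : (π * f).natDegree ≤ d + d := by
      rw [← sub_eq_iff_eq_add.2 h]
      refine (Polynomial.natDegree_sub_le _ _).trans (max_le ?_ (by omega))
      exact Polynomial.natDegree_mul_le.trans (add_le_add had hbd)
    rw [Polynomial.natDegree_mul hπ hf] at h1
    omega
  have h2 := l_steinberg (p := p) (mul_ne_zero hπ hf) hc (by rw [← h]; exact mul_ne_zero ha hb)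
  rw [← h, l_mul hπ hf, l_mul ha hb] at h2
  have h3 : l (p := p) π * (l c - (l a + l b)) = (l a + l b - l f) * (l c - (l a + l b)) := by
    rw [← sub_eq_zero, ← h2]
    noncomm_ring
  rw [h3]
  have := l_mem_degreeLE (p := p) had
  have := l_mem_degreeLE (p := p) hbd
  have := l_mem_degreeLE (p := p) hcd
  have := l_mem_degreeLE (p := p) hfd
  exact mul_mem (sub_mem (add_mem ‹_› ‹_›) ‹_›) (sub_mem ‹_› (add_mem ‹_› ‹_›))

theorem mk_modByMonicHom (w : ClosedPoint K) (y : w.residueField) :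
    AdjoinRoot.mk w.1 (AdjoinRoot.modByMonicHom w.2.1 y) = y :=
  AdjoinRoot.mk_leftInverse w.2.1 y

theorem natDegree_modByMonicHom_lt (w : ClosedPoint K) (y : w.residueField) :
    (AdjoinRoot.modByMonicHom w.2.1 y).natDegree < w.1.natDegree := by
  obtain ⟨f, rfl⟩ := AdjoinRoot.mk_surjective y
  rw [AdjoinRoot.modByMonicHom_mk]
  exact Polynomial.natDegree_modByMonic_lt _ w.2.1 w.2.2.ne_one

theorem modByMonicHom_mk_of_lt (w : ClosedPoint K) {f : Polynomial K}
    (h : f.natDegree < w.1.natDegree) :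
    AdjoinRoot.modByMonicHom w.2.1 (AdjoinRoot.mk w.1 f) = f := by
  rw [AdjoinRoot.modByMonicHom_mk, Polynomial.modByMonic_eq_self_iff w.2.1]
  exact Polynomial.degree_lt_degree h

/-- The lift of elements of the residue field to polynomials of small degree, on free rings. -/
def lift (w : ClosedPoint K) : FreeAlgebra ℤ w.residueField →ₐ[ℤ] KM p (Polynomial K) :=
  FreeAlgebra.lift ℤ fun y => l (AdjoinRoot.modByMonicHom w.2.1 y)

theorem lift_ι (w : ClosedPoint K) (y : w.residueField) :
    w.lift (p := p) (FreeAlgebra.ι ℤ y) = l (AdjoinRoot.modByMonicHom w.2.1 y) :=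
  FreeAlgebra.lift_ι_apply _ _

theorem lift_mem_degreeLE {d : ℕ} (w : ClosedPoint K) (hw : w.1.natDegree = d + 1)
    (z : FreeAlgebra ℤ w.residueField) : w.lift z ∈ degreeLE p K d := by
  induction z using FreeAlgebra.induction with
  | grade0 r =>
    rw [AlgHom.commutes]
    simp
  | grade1 y =>
    rw [lift_ι]
    exact l_mem_degreeLE (by have := w.natDegree_modByMonicHom_lt y; omega)
  | mul a b ha hb => rw [map_mul]; exact mul_mem ha hb
  | add a b ha hb => rw [map_add]; exact add_mem ha hb

theorem sp_lift (w : ClosedPoint K) (z : FreeAlgebra ℤ w.residueField) :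
    w.place.sp (w.lift z) = mk (p := p) z := by
  induction z using FreeAlgebra.induction with
  | grade0 r => rw [AlgHom.commutes]; simp
  | grade1 y =>
    rw [lift_ι, Place.sp_l, w.u_of_natDegree_lt (w.natDegree_modByMonicHom_lt y),
      mk_modByMonicHom, mk_ι]
  | mul a b ha hb => rw [map_mul, map_mul, ha, hb, map_mul]
  | add a b ha hb => rw [map_add, map_add, ha, hb, map_add]

theorem exists_lift_eq {d : ℕ} (w : ClosedPoint K) (hw : w.1.natDegree = d + 1)
    {s : KM p (Polynomial K)} (hs : s ∈ degreeLE p K d) : ∃ z, w.lift z = s := by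
  have h : degreeLE p K d ≤ (w.lift (p := p)).toRingHom.range := by
    refine Subring.closure_le.2 ?_
    rintro _ ⟨f, hf, rfl⟩
    refine ⟨FreeAlgebra.ι ℤ (AdjoinRoot.mk w.1 f), ?_⟩
    have hf' : f.natDegree ≤ d := hf
    exact (w.lift_ι _).trans (by rw [w.modByMonicHom_mk_of_lt (by omega)])
  exact h hs

end

end ClosedPoint

namespace ClosedPoint

noncomputable section

open KM

variable {p : ℕ} {K : Type*} [Field K]

theorem exists_transfer_step {d : ℕ} {T : ∀ w : ClosedPoint K, KM p w.residueField →+ KM p K}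
    (hT : ∀ w, IsLinear w (T w)) (hd : ∀ s ∈ degreeLE p K d, defect T s = 0)
    (π : ClosedPoint K) (hπ : π.1.natDegree = d + 1) :
    ∃ T' : KM p π.residueField →+ KM p K, IsLinear π T' ∧
      ∀ s ∈ degreeLE p K d, T' (π.place.sp s) = -defect T (l π.1 * s) := by
  let τ : FreeAlgebra ℤ π.residueField →+ KM p K :=
    { toFun := fun z => -defect T (l π.1 * π.lift z)
      map_zero' := by simp
      map_add' := fun a b => by simp only [map_add, mul_add, neg_add] }
  have hτ : ∀ z, τ z = -defect T (l π.1 * π.lift z) := fun _ => rfl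
  let r := AdjoinRoot.modByMonicHom π.2.1
  have hr : ∀ x, x ≠ 0 → r x ≠ 0 := fun x hx h => hx (by
    rw [← π.mk_modByMonicHom x]; exact (congrArg _ h).trans (map_zero _))
  have hrd : ∀ x, (r x).natDegree ≤ d := fun x => by
    have : (r x).natDegree < _ := π.natDegree_modByMonicHom_lt x
    omega
  have key : ∀ a b, KRel p π.residueField a b → ∀ x y, τ (x * (a - b) * y) = 0 := by
    intro a b hab x y
    rw [hτ, map_mul π.lift, map_mul π.lift, map_sub π.lift]
    cases hab with
    | char => simp [natCast_eq_zero]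
    | zero => simp [lift_ι, l_zero]
    | mul a b ha hb =>
      rw [map_add, lift_ι, lift_ι, lift_ι]
      change -defect T (l π.1 * (π.lift x * (l (r (a * b)) - (l (r a) + l (r b))) * π.lift y)) = 0
      obtain ⟨f, hf⟩ : π.1 ∣ r a * r b - r (a * b) := by
        rw [← AdjoinRoot.mk_eq_zero, map_sub, map_mul]
        change AdjoinRoot.mk _ (AdjoinRoot.modByMonicHom π.2.1 a) *
          AdjoinRoot.mk _ (AdjoinRoot.modByMonicHom π.2.1 b) -
          AdjoinRoot.mk _ (AdjoinRoot.modByMonicHom π.2.1 (a * b)) = 0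
        rw [mk_modByMonicHom, mk_modByMonicHom, mk_modByMonicHom, sub_self]
      have h := l_mul_mem_degreeLE (p := p) π.2.1.ne_zero (hr a ha) (hr b hb)
        (hr _ (mul_ne_zero ha hb)) (hrd a) (hrd b) (hrd _) hπ (sub_eq_iff_eq_add.1 hf)
      obtain ⟨s, hs, e⟩ := exists_mul_comm
        (W := l (r (a * b)) - (l (r a) + l (r b))) (fun f => by
          rw [mul_sub, mul_add, l_anticomm f, l_anticomm f, l_anticomm f]; noncomm_ring)
        (π.lift_mem_degreeLE (p := p) hπ x)
      rw [e, mul_assoc, ← mul_assoc, hd _ (mul_mem h (mul_mem hs (π.lift_mem_degreeLE hπ y))),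
        neg_zero]
    | add a b ha hb hab =>
      have h : π.lift (p := p) ((FreeAlgebra.ι ℤ a - FreeAlgebra.ι ℤ (a + b)) *
          (FreeAlgebra.ι ℤ b - FreeAlgebra.ι ℤ (a + b))) = 0 := by
        rw [map_mul, map_sub, map_sub, lift_ι, lift_ι, lift_ι, map_add]
        exact l_steinberg (hr a ha) (hr b hb) (by rw [← map_add]; exact hr _ hab)
      rw [h]
      simp
  obtain ⟨T', hT'⟩ := exists_desc τ key
  refine ⟨T', fun z c => ?_, fun s hs => ?_⟩
  · induction c using KM.induction generalizing z with
    | hl c hc =>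
      obtain ⟨z, rfl⟩ := mk_surjective z
      have h1 : π.lift (p := p) (FreeAlgebra.ι ℤ (AdjoinRoot.of π.1 c)) = cst (l c) := by
        rw [lift_ι, map_l]
        exact congrArg l (π.modByMonicHom_mk_of_lt (by
          rw [Polynomial.natDegree_C]; exact π.natDegree_pos))
      rw [map_l, ← mk_ι, ← map_mul, hT', hT', hτ, hτ, map_mul π.lift, h1, ← mul_assoc,
        defect_mul_cst hT, neg_mul]
    | hint n => rw [map_intCast, ← zsmul_eq_mul', map_zsmul, zsmul_eq_mul']
    | hadd a b ha hb => rw [map_add, mul_add, map_add, ha, hb, mul_add]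
    | hmul a b ha hb => rw [map_mul π.ext, ← mul_assoc, hb, ha, mul_assoc]
  · obtain ⟨z, rfl⟩ := π.exists_lift_eq hπ hs
    rw [sp_lift, hT', hτ]

theorem res_l_mul_of_mem {d : ℕ} {w : ClosedPoint K} (hw : w.1.natDegree = d + 1)
    {s : KM p (Polynomial K)} (hs : s ∈ degreeLE p K d) (π : ClosedPoint K) :
    (w = π → w.place.res (l π.1 * s) = w.place.sp s) ∧
    (w ≠ π → w.place.res (l π.1 * s) = 0) := by
  rw [Place.res_l_mul, res_of_mem_degreeLE (by omega) hs, mul_zero, add_zero]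
  constructor
  · rintro rfl
    rw [place, (Place.finite_v_u_self w.2.2).1, Int.cast_one, one_mul]
  · intro h
    rw [place, (Place.finite_v_u_of_not_dvd w.2.2 (not_dvd_of_ne h)).1, Int.cast_zero, zero_mul]

variable (p K) in
/-- Additive generators of the subring `degreeLE p K (d + 1)`. -/
def stepGroup (d : ℕ) : AddSubgroup (KM p (Polynomial K)) :=
  AddSubgroup.closure ({s | s ∈ degreeLE p K d} ∪
    {z | ∃ π : ClosedPoint K, π.1.natDegree = d + 1 ∧ ∃ s ∈ degreeLE p K d, z = l π.1 * s})

theorem mem_stepGroup {d : ℕ} {s : KM p (Polynomial K)} (hs : s ∈ degreeLE p K d) :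
    s ∈ stepGroup p K d := AddSubgroup.subset_closure (Or.inl hs)

theorem l_mul_mem_stepGroup {d : ℕ} {s : KM p (Polynomial K)} (hs : s ∈ degreeLE p K d)
    {π : ClosedPoint K} (hπ : π.1.natDegree = d + 1) :
    l π.1 * s ∈ stepGroup p K d := AddSubgroup.subset_closure (Or.inr ⟨π, hπ, s, hs, rfl⟩)

theorem l_mul_mem_stepGroup_of_le {d : ℕ} {f : Polynomial K} (hf : f.natDegree ≤ d)
    {x : KM p (Polynomial K)} (hx : x ∈ stepGroup p K d) : l f * x ∈ stepGroup p K d := by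
  induction hx using AddSubgroup.closure_induction with
  | mem x hx =>
    rcases hx with hs | ⟨π, hπ, s, hs, rfl⟩
    · exact mem_stepGroup (mul_mem (l_mem_degreeLE hf) hs)
    · rw [← mul_assoc, l_anticomm, neg_mul, mul_assoc]
      exact neg_mem (l_mul_mem_stepGroup (mul_mem (l_mem_degreeLE hf) hs) hπ)
  | zero => simp
  | add a b _ _ ha hb => rw [mul_add]; exact add_mem ha hb
  | neg a _ ha => rw [mul_neg]; exact neg_mem ha

theorem l_mul_l_mul_mem_stepGroup {d : ℕ} {π π' : ClosedPoint K} (hπ : π.1.natDegree = d + 1)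
    (hπ' : π'.1.natDegree = d + 1) {s : KM p (Polynomial K)} (hs : s ∈ degreeLE p K d) :
    l π'.1 * (l π.1 * s) ∈ stepGroup p K d := by
  have h1 : l (p := p) (-1 : Polynomial K) ∈ degreeLE p K d := l_mem_degreeLE (by simp)
  by_cases h : π' = π
  · rw [h, ← mul_assoc, l_mul_self π.2.1.ne_zero, mul_assoc]
    exact l_mul_mem_stepGroup (mul_mem h1 hs) hπ
  have hg : (π'.1 - π.1) ≠ 0 := sub_ne_zero.2 fun e => h (Subtype.ext e)
  have hgd : (π'.1 - π.1).natDegree ≤ d := by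
    have := Polynomial.degree_sub_lt_left (p := π'.1) (q := π.1)
      (by rw [Polynomial.degree_eq_natDegree π'.2.1.ne_zero,
        Polynomial.degree_eq_natDegree π.2.1.ne_zero, hπ, hπ']) π'.2.1.ne_zero
      (by rw [π'.2.1.leadingCoeff, π.2.1.leadingCoeff])
    have := Polynomial.natDegree_lt_natDegree hg this
    omega
  have hmem := l_mem_degreeLE (p := p) hgd
  have h2 := l_steinberg (p := p) π.2.1.ne_zero hg (by simpa using π'.2.1.ne_zero)
  rw [add_sub_cancel] at h2
  have h3 : l (p := p) π'.1 * l π.1 =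
      l π'.1 * (l (π'.1 - π.1) - l (-1)) - l π.1 * l (π'.1 - π.1) := by
    rw [l_anticomm, mul_sub, ← l_mul_self π'.2.1.ne_zero, ← sub_eq_zero, ← h2]
    noncomm_ring
  rw [← mul_assoc, h3, sub_mul, mul_assoc, mul_assoc]
  exact sub_mem (l_mul_mem_stepGroup (mul_mem (sub_mem hmem h1) hs) hπ')
    (l_mul_mem_stepGroup (mul_mem hmem hs) hπ)

theorem l_mul_mem_stepGroup_of_mem {d : ℕ} {π : ClosedPoint K} (hπ : π.1.natDegree = d + 1)
    {x : KM p (Polynomial K)} (hx : x ∈ stepGroup p K d) : l π.1 * x ∈ stepGroup p K d := by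
  induction hx using AddSubgroup.closure_induction with
  | mem x hx =>
    rcases hx with hs | ⟨π, hπ, s, hs, rfl⟩
    · exact l_mul_mem_stepGroup hs hπ
    · exact l_mul_l_mul_mem_stepGroup hπ ‹_› hs
  | zero => simp
  | add a b _ _ ha hb => rw [mul_add]; exact add_mem ha hb
  | neg a _ ha => rw [mul_neg]; exact neg_mem ha

theorem l_mul_mem_stepGroup_of_le_succ {d : ℕ} {f : Polynomial K} (hf : f.natDegree ≤ d + 1)
    {x : KM p (Polynomial K)} (hx : x ∈ stepGroup p K d) : l f * x ∈ stepGroup p K d := by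
  rcases Nat.lt_or_ge d f.natDegree with h | h
  swap
  · exact l_mul_mem_stepGroup_of_le h hx
  have hf0 : f ≠ 0 := by rintro rfl; simp at h
  have hfd : f.natDegree = d + 1 := by omega
  by_cases hi : Irreducible f
  · let π : ClosedPoint K := ⟨f * Polynomial.C f.leadingCoeff⁻¹,
      Polynomial.monic_mul_leadingCoeff_inv hf0, Polynomial.irreducible_mul_leadingCoeff_inv.2 hi⟩
    have hπ : π.1.natDegree = d + 1 :=
      (Polynomial.natDegree_mul_leadingCoeff_inv f hf0).trans hfd
    have e : f = Polynomial.C f.leadingCoeff * π.1 := by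
      change f = Polynomial.C f.leadingCoeff * (f * Polynomial.C f.leadingCoeff⁻¹)
      rw [mul_left_comm, ← Polynomial.C_mul,
        mul_inv_cancel₀ (Polynomial.leadingCoeff_ne_zero.2 hf0), Polynomial.C_1, mul_one]
    rw [e, l_mul (Polynomial.C_ne_zero.2 (Polynomial.leadingCoeff_ne_zero.2 hf0)) π.2.1.ne_zero,
      add_mul]
    exact add_mem (l_mul_mem_stepGroup_of_le (by simp) hx) (l_mul_mem_stepGroup_of_mem hπ hx)
  · obtain ⟨a, b, ha, hb, e⟩ : ∃ a b : Polynomial K, 0 < a.natDegree ∧ 0 < b.natDegree ∧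
        f = a * b := by
      by_contra hcon
      refine hi ⟨fun hu => ?_, fun a b e => ?_⟩
      · rw [Polynomial.natDegree_eq_zero_of_isUnit hu] at h
        omega
      · by_contra hab
        rw [not_or] at hab
        have ha0 : a ≠ 0 := by rintro rfl; simp [e] at hf0
        have hb0 : b ≠ 0 := by rintro rfl; simp [e] at hf0
        refine hcon ⟨a, b, ?_, ?_, e⟩
        · exact Polynomial.natDegree_pos_iff_degree_pos.2
            (Polynomial.degree_pos_of_ne_zero_of_nonunit ha0 hab.1)
        · exact Polynomial.natDegree_pos_iff_degree_pos.2
            (Polynomial.degree_pos_of_ne_zero_of_nonunit hb0 hab.2)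
    have ha0 : a ≠ 0 := by rintro rfl; simp at ha
    have hb0 : b ≠ 0 := by rintro rfl; simp at hb
    rw [e, Polynomial.natDegree_mul ha0 hb0] at hfd
    rw [e, l_mul ha0 hb0, add_mul]
    exact add_mem (l_mul_mem_stepGroup_of_le (by omega) hx)
      (l_mul_mem_stepGroup_of_le (by omega) hx)

theorem mem_stepGroup_of_succ {d : ℕ} {z : KM p (Polynomial K)} (hz : z ∈ degreeLE p K (d + 1)) :
    z ∈ stepGroup p K d := by
  have h : ∀ x ∈ stepGroup p K d, z * x ∈ stepGroup p K d := by
    induction hz using Subring.closure_induction with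
    | mem z hz =>
      obtain ⟨f, hf, rfl⟩ := hz
      exact fun x hx => l_mul_mem_stepGroup_of_le_succ hf hx
    | zero => simp
    | one => simp
    | add a b _ _ ha hb => exact fun x hx => by rw [add_mul]; exact add_mem (ha x hx) (hb x hx)
    | neg a _ ha => exact fun x hx => by rw [neg_mul]; exact neg_mem (ha x hx)
    | mul a b _ _ ha hb => exact fun x hx => by rw [mul_assoc]; exact ha _ (hb x hx)
  simpa using h 1 (mem_stepGroup (one_mem _))

theorem exists_transfer_family (p : ℕ) (K : Type*) [Field K] (d : ℕ) :
    ∃ T : ∀ w : ClosedPoint K, KM p w.residueField →+ KM p K, (∀ w, IsLinear w (T w)) ∧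
      (∀ w, d < w.1.natDegree → T w = 0) ∧ ∀ s ∈ degreeLE p K d, defect T s = 0 := by
  induction d with
  | zero =>
    refine ⟨fun _ => 0, fun w z r => by simp, fun _ _ => rfl, fun s hs => ?_⟩
    rw [defect_apply, (Place.infinity K).res_eq_zero_of_mem (fun x hx => ?_) hs]
    · simp
    · have : x.natDegree = 0 := Nat.le_zero.1 hx
      simp [Place.infinity, this]
  | succ d ih =>
    obtain ⟨T, hT, hT0, hd⟩ := ih
    choose! N hNl hN using exists_transfer_step hT hd
    classical
    let T' : ∀ w : ClosedPoint K, KM p w.residueField →+ KM p K := fun w =>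
      if w.1.natDegree = d + 1 then N w else T w
    have hT'N : ∀ w, w.1.natDegree = d + 1 → T' w = N w := fun w hw => if_pos hw
    have hT'T : ∀ w, w.1.natDegree ≠ d + 1 → T' w = T w := fun w hw => if_neg hw
    have hS : ∀ s ∈ degreeLE p K d, ∀ w, T' w (w.place.res s) = T w (w.place.res s) := by
      intro s hs w
      by_cases hw : w.1.natDegree = d + 1
      · rw [res_of_mem_degreeLE (by omega) hs, map_zero, map_zero]
      · rw [hT'T w hw]
    refine ⟨T', fun w => ?_, fun w hw => ?_, fun z hz => ?_⟩
    · by_cases hw : w.1.natDegree = d + 1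
      · rw [hT'N w hw]; exact hNl w hw
      · rw [hT'T w hw]; exact hT w
    · rw [hT'T w (by omega), hT0 w (by omega)]
    · have hz' := mem_stepGroup_of_succ hz
      clear hz
      induction hz' using AddSubgroup.closure_induction with
      | mem z hz =>
        rcases hz with hs | ⟨π, hπ, s, hs, rfl⟩
        · rw [← hd z hs, defect_apply, defect_apply]
          congr 1
          exact finsum_congr fun w => hS z hs w
        · have h1 : ∀ w, T' w (w.place.res (l π.1 * s)) = T w (w.place.res (l π.1 * s)) +
              Pi.single (M := fun _ => KM p K) π (N π (π.place.sp s)) w := by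
            intro w
            by_cases hw : w.1.natDegree = d + 1
            · rw [hT0 w (by omega), AddMonoidHom.zero_apply, zero_add]
              by_cases hwπ : w = π
              · subst hwπ
                rw [(res_l_mul_of_mem hw hs w).1 rfl, hT'N w hw, Pi.single_eq_same]
              · rw [(res_l_mul_of_mem hw hs π).2 hwπ, map_zero, Pi.single_eq_of_ne hwπ]
            · have hwπ : w ≠ π := by rintro rfl; exact hw hπ
              rw [hT'T w hw, Pi.single_eq_of_ne hwπ, add_zero]
          rw [defect_apply, finsum_congr h1, finsum_add_distrib (finite_support_res T _)
            ((Set.finite_singleton π).subset (Pi.support_single_subset)), ← add_assoc,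
            ← defect_apply, finsum_eq_single _ π (fun w hw => Pi.single_eq_of_ne hw _),
            Pi.single_eq_same, hN π hπ s hs, add_neg_cancel]
      | zero => simp
      | add a b _ _ ha hb => rw [map_add, ha, hb, add_zero]
      | neg a _ ha => rw [map_neg, ha, neg_zero]

end

end ClosedPoint

namespace ClosedPoint

open KM

variable {p : ℕ} {K : Type*} [Field K]

theorem defect_l {w : ClosedPoint K} (T : ∀ w : ClosedPoint K, KM p w.residueField →+ KM p K) :
    defect T (l w.1) = T w 1 - (w.1.natDegree : KM p K) := by
  rw [defect_apply, finsum_eq_single _ w fun v hv => by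
      rw [Place.res_l, place, (Place.finite_v_u_of_not_dvd v.2.2 (not_dvd_of_ne hv)).1,
        Int.cast_zero, map_zero],
    Place.res_l, Place.res_l, place, (Place.finite_v_u_self w.2.2).1, Int.cast_one]
  simp only [Place.infinity, Int.cast_neg, Int.cast_natCast]
  abel

variable (K) in
/-- The origin of the affine line. -/
noncomputable def origin : ClosedPoint K :=
  ⟨Polynomial.X, Polynomial.monic_X, Polynomial.irreducible_X⟩

theorem mk_origin (f : Polynomial K) :
    AdjoinRoot.mk (origin K).1 f = AdjoinRoot.of (origin K).1 (f.coeff 0) := by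
  refine (AdjoinRoot.mk_eq_mk).2 ?_
  change Polynomial.X ∣ _
  rw [Polynomial.X_dvd_iff]
  simp

theorem defect_l_mul_l_neg_X {w : ClosedPoint K} (hw : w ≠ origin K)
    {T : ∀ w : ClosedPoint K, KM p w.residueField →+ KM p K} (hT : ∀ w, IsLinear w (T w))
    (h1 : T (origin K) 1 = 1) :
    defect T (l w.1 * l (-Polynomial.X)) =
      T w (l (-AdjoinRoot.root w.1)) - l (w.1.coeff 0) := by
  have hX : (-Polynomial.X : Polynomial K) ≠ 0 := neg_ne_zero.2 Polynomial.X_ne_zero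
  have hdX : ∀ v : ClosedPoint K, v ≠ origin K → ¬ v.1 ∣ -Polynomial.X := fun v hv h =>
    not_dvd_of_ne hv ((dvd_neg).1 h)
  have e1 : (Place.infinity K).res (l (p := p) w.1 * l (-Polynomial.X)) = 0 := by
    rw [Place.res_l_mul, Place.res_l, Place.sp_l]
    simp [Place.infinity, w.2.1.leadingCoeff]
  have e2 : w.place.res (l (p := p) w.1 * l (-Polynomial.X)) = l (-AdjoinRoot.root w.1) := by
    rw [Place.res_l_mul, Place.res_l, Place.sp_l, place, (Place.finite_v_u_self w.2.2).1,
      (Place.finite_v_u_of_not_dvd w.2.2 (hdX w hw)).1,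
      (Place.finite_v_u_of_not_dvd w.2.2 (hdX w hw)).2, map_neg, AdjoinRoot.mk_X]
    simp
  have e3 : (origin K).place.res (l (p := p) w.1 * l (-Polynomial.X)) =
      -(origin K).ext (l (w.1.coeff 0)) := by
    have h : (origin K).place.v (-Polynomial.X) = 1 := by
      rw [← neg_one_mul, (origin K).place.v_mul _ _ (by simp) Polynomial.X_ne_zero,
        (origin K).v_of_natDegree_lt (by simpa using (origin K).natDegree_pos), zero_add]
      exact (Place.finite_v_u_self (origin K).2.2).1
    rw [Place.res_l_mul, Place.res_l, h, place,
      (Place.finite_v_u_of_not_dvd (origin K).2.2 (not_dvd_of_ne hw.symm)).1,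
      (Place.finite_v_u_of_not_dvd (origin K).2.2 (not_dvd_of_ne hw.symm)).2, mk_origin, map_l]
    simp
  have h0 : ∀ v, v ∉ ({w, origin K} : Set (ClosedPoint K)) →
      T v (v.place.res (l (p := p) w.1 * l (-Polynomial.X))) = 0 := by
    intro v hv
    rw [Set.mem_insert_iff, Set.mem_singleton_iff, not_or] at hv
    rw [Place.res_l_mul, Place.res_l, place,
      (Place.finite_v_u_of_not_dvd v.2.2 (hdX v hv.2)).1,
      (Place.finite_v_u_of_not_dvd v.2.2 (not_dvd_of_ne hv.1)).1]
    simp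
  classical
  rw [defect_apply, finsum_eq_sum_of_support_subset (s := {w, origin K}) _ (fun v hv => by
    by_contra h
    exact hv (h0 v (by simpa using h))), Finset.sum_pair hw, e1, e2, e3, map_neg,
    ← one_mul ((origin K).ext _), hT, h1, one_mul, zero_add, sub_eq_add_neg]

end ClosedPoint

namespace KM

variable {p : ℕ} {K : Type*} [Field K]

/-- The transfer for a simple extension, with the projection formula. -/
theorem exists_transfer {π : Polynomial K} (hm : π.Monic) [hi : Fact (Irreducible π)] :
    ∃ T : KM p (AdjoinRoot π) →+ KM p K,
      (∀ z r, T (z * map (AdjoinRoot.of π) (AdjoinRoot.of π).injective r) = T z * r) ∧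
      T 1 = π.natDegree ∧ (π.coeff 0 ≠ 0 → T (l (-AdjoinRoot.root π)) = l (π.coeff 0)) := by
  let w : ClosedPoint K := ⟨π, hm, hi.out⟩
  obtain ⟨T, hT, -, hd⟩ := ClosedPoint.exists_transfer_family p K π.natDegree
  have hmem : l (p := p) π ∈ ClosedPoint.degreeLE p K π.natDegree :=
    ClosedPoint.l_mem_degreeLE le_rfl
  have hpos : 1 ≤ π.natDegree := hi.out.natDegree_pos
  have hX : (Polynomial.X : Polynomial K).natDegree ≤ π.natDegree := by
    rwa [Polynomial.natDegree_X]
  refine ⟨T w, hT w, sub_eq_zero.1 ((ClosedPoint.defect_l (w := w) T).symm.trans (hd _ hmem)),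
    fun h0 => ?_⟩
  have hw : w ≠ ClosedPoint.origin K := by
    intro h
    have : π = Polynomial.X := congrArg Subtype.val h
    simp [this] at h0
  have h1 := (ClosedPoint.defect_l (w := ClosedPoint.origin K) T).symm.trans
    (hd _ (ClosedPoint.l_mem_degreeLE hX))
  have h2 : (ClosedPoint.origin K).1.natDegree = 1 := Polynomial.natDegree_X
  rw [h2, Nat.cast_one, sub_eq_zero] at h1
  refine sub_eq_zero.1 ((ClosedPoint.defect_l_mul_l_neg_X hw hT h1).symm.trans ?_)
  exact hd _ (mul_mem hmem (ClosedPoint.l_mem_degreeLE (by rwa [Polynomial.natDegree_neg])))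

theorem natDegree_mul_eq_zero {π : Polynomial K} (hm : π.Monic) [Fact (Irreducible π)]
    {r : KM p K} (hr : map (AdjoinRoot.of π) (AdjoinRoot.of π).injective r = 0) :
    (π.natDegree : KM p K) * r = 0 := by
  obtain ⟨T, hT, h1, -⟩ := exists_transfer (p := p) hm
  rw [← h1, ← hT, hr, mul_zero, map_zero]

theorem l_coeff_zero_mul_eq_zero {π : Polynomial K} (hm : π.Monic) [Fact (Irreducible π)]
    {r : KM p K} (hr : map (AdjoinRoot.of π) (AdjoinRoot.of π).injective r = 0) :
    l (π.coeff 0) * r = 0 := by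
  by_cases h0 : π.coeff 0 = 0
  · rw [h0, l_zero, zero_mul]
  obtain ⟨T, hT, -, h1⟩ := exists_transfer (p := p) hm
  rw [← h1 h0, ← hT, hr, mul_zero, map_zero]

/-- An element of `KM p K` killed by an integer prime to `p` vanishes. -/
theorem eq_zero_of_natCast_mul_eq_zero (hp : p.Prime) {n : ℕ} (hn : ¬ p ∣ n) {r : KM p K}
    (h : (n : KM p K) * r = 0) : r = 0 := by
  have hc : IsCoprime (n : ℤ) (p : ℤ) :=
    Nat.isCoprime_iff_coprime.2 ((Nat.Prime.coprime_iff_not_dvd hp).2 hn).symm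
  obtain ⟨a, b, hab⟩ := hc
  have h2 := congrArg (fun z : ℤ => (z : KM p K) * r) hab
  simpa [mul_assoc, h, natCast_eq_zero] using h2.symm

end KM

namespace kMod

noncomputable section

variable {F} {p n : ℕ}

theorem hom_ext {G : Type*} [AddCommGroup G] {f g : kMod F p n →+ G}
    (h : ∀ a, f (symbol F p a) = g (symbol F p a)) : f = g := by
  let q : FreeAbelianGroup (Fin n → Fˣ) →+ kMod F p n :=
    (QuotientAddGroup.mk' (pMul F p n)).comp (QuotientAddGroup.mk' (milnorRel F n))
  have hq : f.comp q = g.comp q := FreeAbelianGroup.lift_ext _ _ h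
  ext α
  obtain ⟨β, rfl⟩ := QuotientAddGroup.mk_surjective α
  obtain ⟨γ, rfl⟩ := QuotientAddGroup.mk_surjective β
  exact DFunLike.congr_fun hq γ

theorem eq_zero_of_symbol (h : ∀ a, symbol F p (n := n) a = 0) (α : kMod F p n) : α = 0 :=
  DFunLike.congr_fun (hom_ext (f := AddMonoidHom.id _) (g := 0) h) α

theorem nsmul_eq_zero (α : kMod F p n) : p • α = 0 := by
  obtain ⟨β, rfl⟩ := QuotientAddGroup.mk_surjective α
  exact (QuotientAddGroup.eq_zero_iff (p • β)).2 (AddSubgroup.subset_closure ⟨β, rfl⟩)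

theorem symbol_eq_add (a : Fin n → Fˣ) (i : Fin n) {u v : Fˣ} (h : a i = u * v) :
    symbol F p a = symbol F p (Function.update a i u) + symbol F p (Function.update a i v) := by
  have h1 : (FreeAbelianGroup.of a - FreeAbelianGroup.of (Function.update a i u) -
      FreeAbelianGroup.of (Function.update a i v)) ∈ milnorRel F n :=
    AddSubgroup.subset_closure (Or.inl ⟨a, i, u, v, h, rfl⟩)
  have h2 := congrArg (QuotientAddGroup.mk' (pMul F p n)) ((QuotientAddGroup.eq_zero_iff _).2 h1)
  exact sub_eq_zero.1 ((sub_add_eq_sub_sub _ _ _).trans h2)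

theorem symbol_eq_zero_of_add_eq_one (a : Fin n → Fˣ) (i j : Fin n) (hij : (i : ℕ) + 1 = j)
    (h : (a i : F) + a j = 1) : symbol F p a = 0 := by
  have h1 : FreeAbelianGroup.of a ∈ milnorRel F n :=
    AddSubgroup.subset_closure (Or.inr ⟨a, i, j, hij, h, rfl⟩)
  exact congrArg (QuotientAddGroup.mk' (pMul F p n)) ((QuotientAddGroup.eq_zero_iff _).2 h1)

theorem exists_cons (u : Fˣ) (n : ℕ) : ∃ c : kMod F p n →+ kMod F p (n + 1),
    ∀ a, c (symbol F p a) = symbol F p (Fin.cons u a : Fin (n + 1) → Fˣ) := by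
  let c₀ : FreeAbelianGroup (Fin n → Fˣ) →+ FreeAbelianGroup (Fin (n + 1) → Fˣ) :=
    FreeAbelianGroup.map fun a => Fin.cons u a
  have hc₀ : ∀ a, c₀ (FreeAbelianGroup.of a) = FreeAbelianGroup.of (Fin.cons u a) :=
    fun a => FreeAbelianGroup.map_of_apply a
  have h₀ : milnorRel F n ≤ (milnorRel F (n + 1)).comap c₀ := by
    refine (AddSubgroup.closure_le _).2 ?_
    rintro z (⟨a, i, x, y, h, rfl⟩ | ⟨a, i, j, hij, h, rfl⟩)
    · refine AddSubgroup.subset_closure (Or.inl ⟨Fin.cons u a, i.succ, x, y, by simpa using h, ?_⟩)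
      rw [map_sub, map_sub, hc₀, hc₀, hc₀, Fin.cons_update, Fin.cons_update]
    · refine AddSubgroup.subset_closure (Or.inr ⟨Fin.cons u a, i.succ, j.succ, by simpa using hij,
        by simpa using h, hc₀ a⟩)
  let c₁ : MilnorK F n →+ MilnorK F (n + 1) := QuotientAddGroup.map _ _ c₀ h₀
  have h₁ : pMul F p n ≤ (pMul F p (n + 1)).comap c₁ := by
    refine (AddSubgroup.closure_le _).2 ?_
    rintro _ ⟨y, rfl⟩
    exact AddSubgroup.subset_closure ⟨c₁ y, map_nsmul c₁ p y⟩
  refine ⟨QuotientAddGroup.map _ _ c₁ h₁, fun a => ?_⟩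
  exact congrArg (fun z => QuotientAddGroup.mk (QuotientAddGroup.mk z)) (hc₀ a)

/-- Multiplication by the symbol of a unit. -/
def cons (u : Fˣ) (n : ℕ) : kMod F p n →+ kMod F p (n + 1) := (exists_cons u n).choose

theorem cons_symbol (u : Fˣ) (a : Fin n → Fˣ) :
    cons u n (symbol F p a) = symbol F p (Fin.cons u a : Fin (n + 1) → Fˣ) :=
  (exists_cons u n).choose_spec a

theorem cons_mul (u v : Fˣ) (n : ℕ) : cons (p := p) (u * v) n = cons u n + cons v n := by
  refine hom_ext fun a => ?_
  rw [AddMonoidHom.add_apply, cons_symbol, cons_symbol, cons_symbol,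
    symbol_eq_add _ 0 (Fin.cons_zero _ _), Fin.update_cons_zero, Fin.update_cons_zero]

theorem cons_cons_eq_zero {u v : Fˣ} (h : (u : F) + v = 1) (n : ℕ) (α : kMod F p n) :
    cons u (n + 1) (cons v n α) = 0 := by
  have : (cons u (n + 1)).comp (cons (p := p) v n) = 0 := hom_ext fun a => by
    rw [AddMonoidHom.comp_apply, cons_symbol, cons_symbol]
    exact symbol_eq_zero_of_add_eq_one _ 0 1 rfl (by simpa using h)
  exact DFunLike.congr_fun this α

/-- The endomorphism of the product of all `kMod F p n` given by multiplication by a symbol. -/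
def shift (u : Fˣ) : AddMonoid.End (∀ n, kMod F p n) where
  toFun f := fun
    | 0 => 0
    | n + 1 => cons u n (f n)
  map_zero' := by funext n; cases n <;> simp
  map_add' f g := by funext n; cases n <;> simp

theorem shift_succ (u : Fˣ) (f : ∀ n, kMod F p n) (n : ℕ) :
    shift u f (n + 1) = cons u n (f n) := rfl

theorem shift_mul (u v : Fˣ) : shift (p := p) (u * v) = shift u + shift v := by
  ext f n
  cases n with
  | zero => exact (add_zero _).symm
  | succ n =>
    change cons (u * v) n (f n) = cons u n (f n) + cons v n (f n)
    rw [cons_mul, AddMonoidHom.add_apply]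

theorem shift_mul_shift {u v : Fˣ} (h : (u : F) + v = 1) :
    shift (p := p) u * shift v = 0 := by
  ext f n
  match n with
  | 0 => rfl
  | 1 => exact map_zero (cons u 0)
  | n + 2 => exact cons_cons_eq_zero h n (f n)

theorem exists_rep (F : Type u) [Field F] (p : ℕ) :
    ∃ g : KM p F →+* AddMonoid.End (∀ n, kMod F p n), ∀ u : Fˣ, g (KM.l (u : F)) = shift u := by
  classical
  let s : F → AddMonoid.End (∀ n, kMod F p n) := fun x =>
    if h : x = 0 then 0 else shift (Units.mk0 x h)
  have hs : ∀ u : Fˣ, s u = shift u := fun u => by simp [s]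
  have hmul : ∀ x y : F, x ≠ 0 → y ≠ 0 → s (x * y) = s x + s y := by
    intro x y hx hy
    lift x to Fˣ using hx.isUnit
    lift y to Fˣ using hy.isUnit
    rw [← Units.val_mul, hs, hs, hs, shift_mul]
  have hp : (p : AddMonoid.End (∀ n, kMod F p n)) = 0 := by
    ext f n
    exact nsmul_eq_zero (f n)
  obtain ⟨g, hg⟩ := KM.exists_lift (p := p) s hp (by simp [s]) hmul (by
    intro x y hx hy hz
    have e : ∀ a : F, a ≠ 0 → s a - s (x + y) = s (a / (x + y)) := fun a ha => by
      rw [sub_eq_iff_eq_add, ← hmul _ _ (div_ne_zero ha hz) hz, div_mul_cancel₀ _ hz]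
    rw [e x hx, e y hy]
    have h1 : x / (x + y) + y / (x + y) = 1 := by rw [← add_div, div_self hz]
    have hx' : x / (x + y) ≠ 0 := div_ne_zero hx hz
    have hy' : y / (x + y) ≠ 0 := div_ne_zero hy hz
    generalize x / (x + y) = x' at h1 hx'
    generalize y / (x + y) = y' at h1 hy'
    lift x' to Fˣ using hx'.isUnit
    lift y' to Fˣ using hy'.isUnit
    rw [hs, hs, shift_mul_shift h1])
  exact ⟨g, fun u => by rw [hg, hs]⟩

theorem symbol_eq_zero (a : Fin n → Fˣ)
    (h : (List.ofFn fun i => KM.l (p := p) (a i : F)).prod = 0) : symbol F p a = 0 := by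
  obtain ⟨g, hg⟩ := exists_rep F p
  let e : ∀ n, kMod F p n := Pi.single 0 (symbol F p (n := 0) (fun i => i.elim0))
  have key : ∀ (n : ℕ) (a : Fin n → Fˣ),
      g (List.ofFn fun i => KM.l (p := p) (a i : F)).prod e n = symbol F p a := by
    intro n
    induction n with
    | zero =>
      intro a
      rw [List.ofFn_zero, List.prod_nil, map_one, Subsingleton.elim a fun i => i.elim0]
      exact Pi.single_eq_same (M := fun n => kMod F p n) 0 _
    | succ n ih =>
      intro a
      rw [List.ofFn_succ, List.prod_cons, map_mul, hg, AddMonoid.End.coe_mul, Function.comp_apply,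
        shift_succ,
        ih (fun i => a i.succ), cons_symbol]
      congr 1
      exact Fin.cons_self_tail a
  rw [← key n a, h, map_zero]
  rfl

end

end kMod

/-- An `L`-valued form of degree `d` in variables from a subfield `K`. -/
def IsForm (K : Type*) {L ι : Type*} [CommRing K] [CommRing L] [Algebra K L] (d : ℕ)
    (f : (ι → K) → L) : Prop :=
  ∃ P : MvPolynomial ι L, P.IsHomogeneous d ∧
    ∀ x, f x = MvPolynomial.eval (fun i => algebraMap K L (x i)) P

namespace IsForm

variable {K L ι κ : Type*} [CommRing K] [CommRing L] [Algebra K L] {d e : ℕ}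

theorem const (c : L) : IsForm K 0 fun _ : ι → K => c :=
  ⟨MvPolynomial.C c, isHomogeneous_C _ _, fun x => by simp⟩

theorem zero : IsForm K d fun _ : ι → K => (0 : L) :=
  ⟨0, isHomogeneous_zero _ _ _, fun x => by simp⟩

theorem add {f g : (ι → K) → L} (hf : IsForm K d f) (hg : IsForm K d g) :
    IsForm K d fun x => f x + g x := by
  obtain ⟨P, hP, eP⟩ := hf
  obtain ⟨Q, hQ, eQ⟩ := hg
  exact ⟨P + Q, hP.add hQ, fun x => by simp only [eP, eQ, map_add]⟩

theorem mul {f g : (ι → K) → L} (hf : IsForm K d f) (hg : IsForm K e g) :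
    IsForm K (d + e) fun x => f x * g x := by
  obtain ⟨P, hP, eP⟩ := hf
  obtain ⟨Q, hQ, eQ⟩ := hg
  exact ⟨P * Q, hP.mul hQ, fun x => by simp only [eP, eQ, map_mul]⟩

theorem const_mul {f : (ι → K) → L} (c : L) (hf : IsForm K d f) :
    IsForm K d fun x => c * f x := by
  simpa using (const c).mul hf

theorem sub {f g : (ι → K) → L} (hf : IsForm K d f) (hg : IsForm K d g) :
    IsForm K d fun x => f x - g x := by
  simpa [sub_eq_add_neg] using hf.add (hg.const_mul (-1))

theorem sum {α : Type*} (s : Finset α) {f : α → (ι → K) → L} (hf : ∀ a ∈ s, IsForm K d (f a)) :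
    IsForm K d fun x => ∑ a ∈ s, f a x := by
  classical
  induction s using Finset.induction_on with
  | empty => simpa using zero
  | insert a s ha ih =>
    simp only [Finset.sum_insert ha]
    exact (hf a (by simp)).add (ih fun b hb => hf b (by simp [hb]))

theorem prod {α : Type*} (s : Finset α) {f : α → (ι → K) → L} (hf : ∀ a ∈ s, IsForm K d (f a)) :
    IsForm K (s.card * d) fun x => ∏ a ∈ s, f a x := by
  classical
  induction s using Finset.induction_on with
  | empty => simpa using const 1
  | insert a s ha ih =>
    simp only [Finset.prod_insert ha]
    have := (hf a (by simp)).mul (ih fun b hb => hf b (by simp [hb]))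
    rwa [Finset.card_insert_of_notMem ha, add_one_mul, add_comm]

theorem det {α : Type*} [Fintype α] [DecidableEq α] {M : (ι → K) → Matrix α α L}
    (hM : ∀ i j, IsForm K d fun x => M x i j) :
    IsForm K (Fintype.card α * d) fun x => (M x).det := by
  simp only [Matrix.det_apply']
  exact sum _ fun σ _ => (prod _ fun i _ => hM _ _).const_mul _

theorem linear [Fintype ι] (g : (ι → K) →ₗ[K] L) : IsForm K 1 g := by
  classical
  refine ⟨∑ i, MvPolynomial.C (g (Pi.single i 1)) * MvPolynomial.X i,
    IsHomogeneous.sum _ _ _ fun i _ => by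
      simpa using (isHomogeneous_C _ _).mul (isHomogeneous_X _ i), fun x => ?_⟩
  conv_lhs => rw [pi_eq_sum_univ' x, map_sum]
  simp only [map_sum, map_mul, map_smul, MvPolynomial.eval_C, MvPolynomial.eval_X]
  exact Finset.sum_congr rfl fun i _ => by rw [Algebra.smul_def, mul_comm]

theorem comp {h : (κ → L) → L} (hh : IsForm L d h) {g : (ι → K) → κ → L}
    (hg : ∀ k, IsForm K e fun x => g x k) : IsForm K (d * e) fun x => h (g x) := by
  obtain ⟨P, hP, eP⟩ := hh
  choose Q hQ eQ using hg
  refine ⟨MvPolynomial.bind₁ Q P, ?_, fun x => ?_⟩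
  · have := hP.aeval Q hQ
    rwa [mul_comm] at this
  · simp only [eP, eQ, MvPolynomial.eval, MvPolynomial.eval₂Hom_bind₁]
    rfl

theorem linear_comp (c : L →ₗ[K] K) {f : (ι → K) → L} (hf : IsForm K d f) :
    IsForm K d fun x => c (f x) := by
  obtain ⟨P, hP, eP⟩ := hf
  refine ⟨∑ m ∈ P.support, MvPolynomial.monomial m (c (P.coeff m)),
    IsHomogeneous.sum _ _ _ fun m hm => isHomogeneous_monomial _ (by
      have := hP (MvPolynomial.mem_support_iff.1 hm)
      rwa [Finsupp.degree_eq_weight_one]), fun x => ?_⟩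
  beta_reduce
  rw [eP, MvPolynomial.eval_eq, map_sum, map_sum]
  refine Finset.sum_congr rfl fun m _ => ?_
  rw [MvPolynomial.eval_monomial]
  simp only [← map_pow, ← map_prod, Finsupp.prod, Algebra.algebraMap_self, RingHom.id_apply]
  rw [mul_comm, ← Algebra.smul_def, map_smul, smul_eq_mul, mul_comm]

end IsForm

theorem IsCField.card_le {K : Type u} [Field K] {n d : ℕ} (hC : IsCField K n) (hd : 0 < d)
    {ι : Type*} [Fintype ι] {f : (ι → K) → K} (hf : IsForm K d f) (h0 : ∀ x, f x = 0 → x = 0) :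
    Fintype.card ι ≤ d ^ n := by
  obtain ⟨P, hP, eP⟩ := hf
  by_contra! h
  obtain ⟨x, hx, hx0⟩ := hC d _ hd h (MvPolynomial.rename (Fintype.equivFin ι) P)
    hP.rename_isHomogeneous
  refine hx (funext fun i => ?_)
  rw [MvPolynomial.eval_rename] at hx0
  have := congrFun (h0 (x ∘ Fintype.equivFin ι) ((eP _).trans hx0)) ((Fintype.equivFin ι).symm i)
  simpa using this

theorem IsForm.exists_iterate {E ι : Type*} [Field E] [Fintype ι] {d : ℕ} {f : (ι → E) → E}
    (hf : IsForm E d f) (h0 : ∀ x, f x = 0 → x = 0) (k : ℕ) :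
    ∃ g : ((Fin k → ι) → E) → E, IsForm E (d ^ k) g ∧ ∀ x, g x = 0 → x = 0 := by
  induction k with
  | zero =>
    refine ⟨_, IsForm.linear (LinearMap.proj (default : Fin 0 → ι)), fun x hx => funext fun t => ?_⟩
    rw [Subsingleton.elim t default]
    exact hx
  | succ k ih =>
    obtain ⟨g, hg, hg0⟩ := ih
    have hs (i : ι) : IsForm E (d ^ k * 1) fun x : (Fin (k + 1) → ι) → E =>
        g (LinearMap.funLeft E E (Fin.cons i) x) :=
      hg.comp fun t => IsForm.linear (LinearMap.proj (R := E) (φ := fun _ => E) t ∘ₗ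
        LinearMap.funLeft E E (Fin.cons (α := fun _ => ι) i))
    refine ⟨fun x => f fun i => g (LinearMap.funLeft E E (Fin.cons i) x), ?_, fun x hx => ?_⟩
    · have := hf.comp hs
      rwa [mul_one, ← pow_succ'] at this
    · ext t
      have := congrFun (hg0 _ (congrFun (h0 _ hx) (t 0))) (Fin.tail t)
      rwa [LinearMap.funLeft_apply, Fin.cons_self_tail] at this

theorem IsForm.exists_norm {K E κ : Type*} [Field K] [Field E] [Algebra K E]
    [FiniteDimensional K E] [Fintype κ] {d : ℕ} {f : (κ → E) → E} (hf : IsForm E d f)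
    (h0 : ∀ x, f x = 0 → x = 0) :
    ∃ g : (κ × Fin (Module.finrank K E) → K) → K, IsForm K (Module.finrank K E * d) g ∧
      ∀ x, g x = 0 → x = 0 := by
  let b := Module.finBasis K E
  let c (k : κ) : (κ × Fin (Module.finrank K E) → K) →ₗ[K] E :=
    b.equivFun.symm.toLinearMap ∘ₗ LinearMap.funLeft K K (Prod.mk k)
  have hc : IsForm K (d * 1) fun y => f fun k => c k y :=
    hf.comp fun k => IsForm.linear (c k)
  refine ⟨fun y => Algebra.norm K (f fun k => c k y), ?_, fun y hy => ?_⟩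
  · have := IsForm.det (M := fun y => Algebra.leftMulMatrix b (f fun k => c k y)) (d := d * 1)
      fun i j => by
        simp only [Algebra.leftMulMatrix_eq_repr_mul]
        exact hc.linear_comp (b.coord i ∘ₗ LinearMap.mulRight K (b j))
    simpa [Algebra.norm_eq_matrix_det b] using this
  · ext ⟨k, j⟩
    have h := congrFun (h0 _ (Algebra.norm_eq_zero_iff.1 hy)) k
    exact congrFun (b.equivFun.symm.map_eq_zero_iff.1 h) j

theorem Nat.le_of_forall_mul_pow_le {e N D C : ℕ} (he : 0 < e)
    (h : ∀ k, e * N ^ k ≤ C * D ^ k) : N ≤ D := by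
  by_contra! hlt
  rcases Nat.eq_zero_or_pos D with rfl | hD
  · have := h 1
    simp only [pow_one, mul_zero] at this
    have := Nat.mul_pos he hlt
    omega
  · have h1 : (1 : ℝ) < N / D := by
      rw [one_lt_div (by exact_mod_cast hD)]
      exact_mod_cast hlt
    obtain ⟨k, hk⟩ := pow_unbounded_of_one_lt (C : ℝ) h1
    rw [div_pow, lt_div_iff₀ (by positivity)] at hk
    have h2 : C * D ^ k < N ^ k := by exact_mod_cast hk
    have := h k
    have := Nat.le_mul_of_pos_left (N ^ k) he
    omega

theorem IsCField.card_le_of_finite {K : Type u} [Field K] {n d : ℕ} (hC : IsCField K n)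
    {E ι : Type*} [Field E] [Algebra K E] [FiniteDimensional K E] [Fintype ι] (hd : 0 < d)
    {f : (ι → E) → E} (hf : IsForm E d f) (h0 : ∀ x, f x = 0 → x = 0) :
    Fintype.card ι ≤ d ^ n := by
  have he : 0 < Module.finrank K E := Module.finrank_pos
  refine Nat.le_of_forall_mul_pow_le (C := Module.finrank K E ^ n) he fun k => ?_
  obtain ⟨g, hg, hg0⟩ := hf.exists_iterate h0 k
  obtain ⟨g', hg', hg0'⟩ := hg.exists_norm (K := K) hg0
  have := hC.card_le (by positivity) hg' hg0'
  rw [mul_pow, ← pow_mul, mul_comm k, pow_mul] at this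
  simpa [mul_comm] using this

/-- The matrix of the `b`-twisted cyclic shift, with `cyclicShift p b ^ p = b`. -/
def cyclicShift {L : Type*} [CommRing L] (p : ℕ) [NeZero p] (b : L) : Matrix (Fin p) (Fin p) L :=
  Matrix.of fun i => if h : (i : ℕ) + 1 < p then Pi.single ⟨i + 1, h⟩ 1 else Pi.single 0 b

/-- The matrix, over a maximal subfield, of an element of a cyclic algebra. -/
def cyclicMatrix {L : Type*} [CommRing L] {p : ℕ} [NeZero p] (σ : L →+* L) (b : L)
    (x : Fin p → L) : Matrix (Fin p) (Fin p) L :=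
  Matrix.of fun i => Matrix.vecMul ((σ ^ (i : ℕ)) ∘ x) (cyclicShift p b ^ (i : ℕ))

section CyclicMatrix

variable {L : Type*} [CommRing L]

theorem Matrix.row_mul {ι κ μ : Type*} [Fintype κ] (A : Matrix ι κ L) (B : Matrix κ μ L) (i : ι) :
    (A * B).row i = Matrix.vecMul (A.row i) B :=
  Matrix.mul_apply_eq_vecMul A B i

variable {p : ℕ} [NeZero p] (b : L)

theorem row_cyclicShift_of_lt {i : Fin p} (h : (i : ℕ) + 1 < p) :
    (cyclicShift p b).row i = Pi.single ⟨i + 1, h⟩ 1 :=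
  dif_pos h

theorem row_cyclicShift_of_not_lt {i : Fin p} (h : ¬ (i : ℕ) + 1 < p) :
    (cyclicShift p b).row i = Pi.single 0 b :=
  dif_neg h

theorem row_cyclicMatrix (σ : L →+* L) (x : Fin p → L) (i : Fin p) :
    (cyclicMatrix σ b x).row i =
      Matrix.vecMul ((σ ^ (i : ℕ)) ∘ x) (cyclicShift p b ^ (i : ℕ)) :=
  rfl

theorem single_zero_vecMul_cyclicShift_pow {i : ℕ} (hi : i < p) :
    Matrix.vecMul (Pi.single 0 1) (cyclicShift p b ^ i) = Pi.single ⟨i, hi⟩ 1 := by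
  induction i with
  | zero => simp
  | succ i ih =>
    rw [pow_succ, ← Matrix.vecMul_vecMul, ih (by omega), Matrix.single_one_vecMul,
      row_cyclicShift_of_lt]

theorem cyclicShift_pow : cyclicShift p b ^ p = b • (1 : Matrix (Fin p) (Fin p) L) := by
  have hp : 0 < p := Nat.pos_of_ne_zero (NeZero.ne p)
  have h0 : Matrix.vecMul (Pi.single 0 1) (cyclicShift p b ^ p) = b • Pi.single (0 : Fin p) 1 := by
    have : cyclicShift p b ^ p = cyclicShift p b ^ (p - 1) * cyclicShift p b := by
      rw [← pow_succ, Nat.sub_add_cancel hp]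
    rw [this, ← Matrix.vecMul_vecMul, single_zero_vecMul_cyclicShift_pow b (by omega),
      Matrix.single_one_vecMul, row_cyclicShift_of_not_lt b (by simp; omega), ← Pi.single_smul]
    simp
  refine Matrix.ext_row fun i => ?_
  rw [← Matrix.single_one_vecMul, ← single_zero_vecMul_cyclicShift_pow b i.2, Matrix.vecMul_vecMul,
    ← pow_add, add_comm, pow_add, ← Matrix.vecMul_vecMul, h0, Matrix.smul_vecMul,
    single_zero_vecMul_cyclicShift_pow b i.2]
  ext j
  simp [Matrix.one_apply, Pi.single_apply, eq_comm]

theorem cyclicShift_map {σ : L →+* L} (hb : σ b = b) :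
    (cyclicShift p b).map σ = cyclicShift p b := by
  refine Matrix.ext_row fun i => ?_
  rw [Matrix.row_map]
  by_cases h : (i : ℕ) + 1 < p
  · rw [row_cyclicShift_of_lt b h]
    ext j
    simp [Pi.single_apply, apply_ite σ]
  · rw [row_cyclicShift_of_not_lt b h]
    ext j
    simp [Pi.single_apply, apply_ite σ, hb]

theorem cyclicMatrix_add (σ : L →+* L) (x y : Fin p → L) :
    cyclicMatrix σ b (x + y) = cyclicMatrix σ b x + cyclicMatrix σ b y := by
  refine Matrix.ext_row fun i => ?_
  have : (σ ^ (i : ℕ)) ∘ (x + y) = (σ ^ (i : ℕ)) ∘ x + (σ ^ (i : ℕ)) ∘ y :=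
    funext fun j => map_add _ _ _
  rw [row_cyclicMatrix, this, Matrix.add_vecMul]
  rfl

theorem RingHom.pow_apply_of_apply_eq {σ : L →+* L} {c : L} (hc : σ c = c) (i : ℕ) :
    (σ ^ i) c = c := by
  induction i with
  | zero => rfl
  | succ i ih => rw [pow_succ, RingHom.mul_def, RingHom.comp_apply, hc, ih]

theorem cyclicMatrix_single (σ : L →+* L) (c : L) :
    cyclicMatrix σ b (Pi.single (0 : Fin p) c) =
      Matrix.diagonal fun i : Fin p => (σ ^ (i : ℕ)) c := by
  refine Matrix.ext_row fun i => ?_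
  have : (σ ^ (i : ℕ)) ∘ (Pi.single 0 c : Fin p → L) =
      (σ ^ (i : ℕ)) c • Pi.single (0 : Fin p) 1 := by
    ext j
    rw [Function.comp_apply, Pi.smul_apply, Pi.single_apply, Pi.single_apply]
    split_ifs
    · rw [smul_eq_mul, mul_one]
    · rw [map_zero, smul_zero]
  rw [row_cyclicMatrix, this, Matrix.smul_vecMul, single_zero_vecMul_cyclicShift_pow b i.2,
    Matrix.row_diagonal, ← Pi.single_smul, smul_eq_mul, mul_one]

theorem map_comp_vecMul_cyclicShift {σ : L →+* L} (hb : σ b = b) (x : Fin p → L) (i : ℕ) :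
    Matrix.vecMul (σ ∘ Matrix.vecMul ((σ ^ i) ∘ x) (cyclicShift p b ^ i)) (cyclicShift p b) =
      Matrix.vecMul ((σ ^ (i + 1)) ∘ x) (cyclicShift p b ^ (i + 1)) := by
  have : σ ∘ Matrix.vecMul ((σ ^ i) ∘ x) (cyclicShift p b ^ i) =
      Matrix.vecMul ((σ ^ (i + 1)) ∘ x) (cyclicShift p b ^ i) := by
    ext j
    have h : (cyclicShift p b ^ i).map σ = (cyclicShift p b) ^ i := by
      rw [← RingHom.mapMatrix_apply, map_pow, RingHom.mapMatrix_apply, cyclicShift_map b hb]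
    rw [Function.comp_apply, RingHom.map_vecMul, h, pow_succ' σ]
    rfl
  rw [this, Matrix.vecMul_vecMul, ← pow_succ]

theorem cyclicShift_mul_cyclicMatrix {σ : L →+* L} (hb : σ b = b) (hσ : σ ^ p = 1)
    (x : Fin p → L) :
    cyclicShift p b * cyclicMatrix σ b x = (cyclicMatrix σ b x).map σ * cyclicShift p b := by
  refine Matrix.ext_row fun i => ?_
  rw [Matrix.row_mul, Matrix.row_mul, Matrix.row_map, row_cyclicMatrix,
    map_comp_vecMul_cyclicShift b hb]
  by_cases h : (i : ℕ) + 1 < p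
  · rw [row_cyclicShift_of_lt b h, Matrix.single_one_vecMul, row_cyclicMatrix]
  · have hi : (i : ℕ) + 1 = p := by omega
    rw [hi, hσ, cyclicShift_pow, row_cyclicShift_of_not_lt b h, Matrix.single_vecMul,
      row_cyclicMatrix, Matrix.vecMul_smul, Matrix.vecMul_one]
    ext j
    simp

theorem charpoly_map_cyclicMatrix {L : Type*} [Field L] {b : L} (hb0 : b ≠ 0) {σ : L →+* L}
    (hb : σ b = b) (hσ : σ ^ p = 1) (x : Fin p → L) :
    (-cyclicMatrix σ b x).charpoly.map σ = (-cyclicMatrix σ b x).charpoly := by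
  have hu : IsUnit (cyclicShift p b) := by
    refine isUnit_pow_iff (NeZero.ne p) |>.1 ?_
    rw [cyclicShift_pow]
    simp [Matrix.isUnit_iff_isUnit_det, hb0]
  obtain ⟨u, hu⟩ := hu
  have h : -((cyclicMatrix σ b x).map σ) = u.val * -cyclicMatrix σ b x * u⁻¹.val := by
    rw [Units.eq_mul_inv_iff_mul_eq, mul_neg, hu, cyclicShift_mul_cyclicMatrix b hb hσ, neg_mul]
  rw [Matrix.coe_units_inv] at h
  rw [← Matrix.charpoly_map, ← Matrix.charpoly_units_conj u (-cyclicMatrix σ b x), ← h]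
  congr 1
  ext i j
  simp

theorem cyclicMatrix_map {L' : Type*} [CommRing L'] (φ : L →+* L') {σ : L →+* L} {τ : L' →+* L'}
    (h : ∀ y, φ (σ y) = τ (φ y)) (x : Fin p → L) :
    (cyclicMatrix σ b x).map φ = cyclicMatrix τ (φ b) (φ ∘ x) := by
  have h1 (i : ℕ) (y : L) : φ ((σ ^ i) y) = (τ ^ i) (φ y) := by
    induction i generalizing y with
    | zero => rfl
    | succ i ih => rw [pow_succ, pow_succ, RingHom.mul_def, RingHom.comp_apply, ih, h]; rfl
  have h2 : (cyclicShift p b).map φ = cyclicShift p (φ b) := by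
    refine Matrix.ext_row fun i => ?_
    rw [Matrix.row_map]
    by_cases h : (i : ℕ) + 1 < p
    · rw [row_cyclicShift_of_lt b h, row_cyclicShift_of_lt _ h]
      ext j
      simp [Pi.single_apply, apply_ite φ]
    · rw [row_cyclicShift_of_not_lt b h, row_cyclicShift_of_not_lt _ h]
      ext j
      simp [Pi.single_apply, apply_ite φ]
  refine Matrix.ext_row fun i => ?_
  rw [Matrix.row_map, row_cyclicMatrix, row_cyclicMatrix, ← h2, ← RingHom.mapMatrix_apply,
    ← map_pow]
  ext j
  rw [Function.comp_apply, RingHom.map_vecMul]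
  congr 2
  ext k
  exact h1 _ _

end CyclicMatrix

theorem exists_prod_eq_pow_of_det_eq_zero {L : Type*} [Field L] {p : ℕ} [NeZero p] {b : L}
    {σ : L →+* L} (hb : σ b = b) (hσ : σ ^ p = 1) {x : Fin p → L} (hx : x ≠ 0)
    (h : (cyclicMatrix σ b x).det = 0) :
    ∃ r, 0 < r ∧ r < p ∧ ∃ δ : L, ∏ i ∈ Finset.range p, (σ ^ i) δ = b ^ r := by
  set M := cyclicMatrix σ b x with hM
  let W := Submodule.span L (Set.range M.row)
  have hrow (i : Fin p) : M.row i ∈ W := Submodule.subset_span ⟨i, rfl⟩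
  have hstable (w : Fin p → L) (hw : w ∈ W) : Matrix.vecMul (σ ∘ w) (cyclicShift p b) ∈ W := by
    induction hw using Submodule.span_induction with
    | mem w hw =>
      obtain ⟨i, rfl⟩ := hw
      have h1 : Matrix.vecMul (σ ∘ M.row i) (cyclicShift p b) = (cyclicShift p b * M).row i := by
        rw [hM, cyclicShift_mul_cyclicMatrix b hb hσ, Matrix.row_mul, Matrix.row_map]
      rw [h1, Matrix.row_mul, Matrix.vecMul_eq_sum]
      exact W.sum_mem fun j _ => W.smul_mem _ (hrow j)
    | zero =>
      have : σ ∘ (0 : Fin p → L) = 0 := funext fun j => map_zero σ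
      rw [this, Matrix.zero_vecMul]
      exact W.zero_mem
    | add w v _ _ hw hv =>
      have : σ ∘ (w + v) = σ ∘ w + σ ∘ v := funext fun j => map_add σ _ _
      rw [this, Matrix.add_vecMul]
      exact W.add_mem hw hv
    | smul c w _ hw =>
      have : σ ∘ (c • w) = σ c • σ ∘ w := funext fun j => map_mul σ _ _
      rw [this, Matrix.smul_vecMul]
      exact W.smul_mem _ hw
  have hpos : 0 < Module.finrank L W := by
    refine Module.finrank_pos_iff_exists_ne_zero.2 ⟨⟨_, hrow 0⟩, fun h0 => hx ?_⟩
    have h1 := congrArg Subtype.val h0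
    simpa [hM, row_cyclicMatrix] using h1
  have hlt : Module.finrank L W < p := by
    refine lt_of_le_of_ne ((finrank_range_le_card M.row).trans_eq (Fintype.card_fin p)) fun hr => ?_
    have := linearIndependent_iff_card_eq_finrank_span (b := M.row) |>.2
      ((Fintype.card_fin p).trans hr.symm)
    rw [Matrix.linearIndependent_rows_iff_isUnit, Matrix.isUnit_iff_isUnit_det, h] at this
    exact not_isUnit_zero this
  refine ⟨_, hpos, hlt, ?_⟩
  let w := Module.finBasis L W
  let B : Matrix (Fin (Module.finrank L W)) (Fin p) L := Matrix.of fun i => (w i : Fin p → L)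
  have hBinj {C D : Matrix (Fin (Module.finrank L W)) (Fin (Module.finrank L W)) L}
      (hCD : C * B = D * B) : C = D := by
    have hli : LinearIndependent L B.row :=
      w.linearIndependent.map' W.subtype (Submodule.ker_subtype W)
    refine Matrix.ext_row fun i => Matrix.vecMul_injective_iff.2 hli ?_
    change Matrix.vecMul (C.row i) B = Matrix.vecMul (D.row i) B
    rw [← Matrix.row_mul, hCD, Matrix.row_mul]
  let A : Matrix (Fin (Module.finrank L W)) (Fin (Module.finrank L W)) L :=
    Matrix.of fun i => w.equivFun ⟨_, hstable _ (w i).2⟩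
  have hA : B.map σ * cyclicShift p b = A * B := by
    refine Matrix.ext_row fun i => ?_
    rw [Matrix.row_mul, Matrix.row_mul, Matrix.row_map, Matrix.vecMul_eq_sum (A.row i)]
    have := congrArg Subtype.val (w.sum_equivFun ⟨_, hstable _ (w i).2⟩)
    rw [Submodule.coe_sum] at this
    exact this.symm
  have key (k : ℕ) : ∃ C : Matrix (Fin (Module.finrank L W)) (Fin (Module.finrank L W)) L,
      B.map (σ ^ k) * cyclicShift p b ^ k = C * B ∧
        C.det = ∏ i ∈ Finset.range k, (σ ^ i) A.det := by
    induction k with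
    | zero => exact ⟨1, by simp [RingHom.one_def], by simp⟩
    | succ k ih =>
      obtain ⟨C, hC, hdet⟩ := ih
      refine ⟨C.map σ * A, ?_, ?_⟩
      · have h1 := congrArg (fun Z => Matrix.map Z σ) hC
        simp only [Matrix.map_mul] at h1
        have h2 : (cyclicShift p b ^ k).map σ = cyclicShift p b ^ k := by
          rw [← RingHom.mapMatrix_apply, map_pow, RingHom.mapMatrix_apply, cyclicShift_map b hb]
        rw [h2] at h1
        rw [Matrix.mul_assoc, ← hA, ← Matrix.mul_assoc, ← h1, Matrix.mul_assoc, ← pow_succ,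
          pow_succ' σ]
        rfl
      · rw [Matrix.det_mul, ← RingHom.mapMatrix_apply, ← RingHom.map_det, hdet,
          Finset.prod_range_succ', map_prod]
        simp only [pow_succ' σ]
        rfl
  obtain ⟨C, hC, hdet⟩ := key p
  refine ⟨A.det, ?_⟩
  rw [hσ, cyclicShift_pow] at hC
  have : C = b • 1 := hBinj (by rw [← hC]; simp [RingHom.one_def])
  rw [← hdet, this]
  simp

theorem KM.l_eq_zero_of_pow_eq {p : ℕ} {R : Type*} [CommRing R] [IsDomain R] {x c : R}
    (h : x ^ p = c) : KM.l (p := p) c = 0 := by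
  rw [← h]
  by_cases hx : x = 0
  · rcases Nat.eq_zero_or_pos p with rfl | hp
    · rw [pow_zero, KM.l_one]
    · rw [hx, zero_pow hp.ne', KM.l_zero]
  · rw [KM.l_pow hx, KM.natCast_eq_zero, zero_mul]

section Kummer

open scoped IntermediateField

variable {K : Type*} [Field K] {p : ℕ} {ζ a : K}

/-- The generator `ᵖ√a ↦ ζ ᵖ√a` of the Galois group of a Kummer extension. -/
structure IsKummerGenerator (p : ℕ) (ζ a : K)
    (σ : AdjoinRoot (Polynomial.X ^ p - Polynomial.C a) →+*
      AdjoinRoot (Polynomial.X ^ p - Polynomial.C a)) : Prop where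
  map_of : ∀ c, σ (AdjoinRoot.of _ c) = AdjoinRoot.of _ c
  map_root : σ (AdjoinRoot.root _) = AdjoinRoot.of _ ζ * AdjoinRoot.root _
  pow_eq_one : σ ^ p = 1
  exists_of_eq : ∀ y, σ y = y → ∃ c, AdjoinRoot.of _ c = y
  of_norm : ∀ y, AdjoinRoot.of _ (Algebra.norm K y) = ∏ i ∈ Finset.range p, (σ ^ i) y

theorem exists_isKummerGenerator [NeZero p] (hζ : IsPrimitiveRoot ζ p)
    [hi : Fact (Irreducible (Polynomial.X ^ p - Polynomial.C a))] :
    ∃ σ, IsKummerGenerator p ζ a σ := by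
  have hne : (primitiveRoots p K).Nonempty :=
    ⟨ζ, (mem_primitiveRoots (NeZero.pos p)).2 hζ⟩
  have := isSplittingField_AdjoinRoot_X_pow_sub_C hne hi.out
  have hG : IsGalois K (AdjoinRoot (Polynomial.X ^ p - Polynomial.C a)) :=
    isGalois_of_isSplittingField_X_pow_sub_C hne hi.out _
  have hfr : Module.finrank K (AdjoinRoot (Polynomial.X ^ p - Polynomial.C a)) = p :=
    finrank_of_isSplittingField_X_pow_sub_C hne hi.out _
  have hfd : FiniteDimensional K (AdjoinRoot (Polynomial.X ^ p - Polynomial.C a)) :=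
    Polynomial.IsSplittingField.finiteDimensional _ (Polynomial.X ^ p - Polynomial.C a)
  let τ : Gal(AdjoinRoot (Polynomial.X ^ p - Polynomial.C a)/K) :=
    autAdjoinRootXPowSubCEquiv hne hi.out hζ.toRootsOfUnity
  have hord : orderOf τ = p := by
    rw [MulEquiv.orderOf_eq, ← orderOf_submonoid, ← orderOf_units]
    exact hζ.eq_orderOf.symm
  have hcard : Nat.card Gal(AdjoinRoot (Polynomial.X ^ p - Polynomial.C a)/K) = p := by
    rw [IsGalois.card_aut_eq_finrank, hfr]
  have hbij : Function.Bijective fun i : Fin p => τ ^ (i : ℕ) := by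
    refine (Nat.bijective_iff_injective_and_card _).2 ⟨fun i j hij => Fin.ext ?_, ?_⟩
    · exact pow_injOn_Iio_orderOf (hord.symm ▸ i.2) (hord.symm ▸ j.2) hij
    · rw [hcard, Nat.card_eq_fintype_card, Fintype.card_fin]
  let σ : AdjoinRoot (Polynomial.X ^ p - Polynomial.C a) →+*
        AdjoinRoot (Polynomial.X ^ p - Polynomial.C a) := (τ : _ →+* _)
  have hpow (i : ℕ) (y) : (σ ^ i) y = (τ ^ i) y := by
    induction i with
    | zero => rfl
    | succ i ih => rw [pow_succ', pow_succ', RingHom.mul_def, RingHom.comp_apply, ih]; rfl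
  refine ⟨σ, fun c => τ.commutes c, ?_, ?_, fun y hy => ?_, fun y => ?_⟩
  · refine (autAdjoinRootXPowSubCEquiv_root hne hi.out hζ.toRootsOfUnity).trans ?_
    rw [Algebra.smul_def]
    rfl
  · refine RingHom.ext fun y => ?_
    have h1 : τ ^ p = 1 := orderOf_dvd_iff_pow_eq_one.1 hord.dvd
    rw [hpow, h1]
    rfl
  · refine (IsGalois.mem_range_algebraMap_iff_fixed (F := K) y).2 fun g => ?_
    obtain ⟨i, rfl⟩ := hbij.2 g
    change (τ ^ (i : ℕ)) y = y
    rw [← hpow, RingHom.pow_apply_of_apply_eq hy]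
  · refine (Algebra.norm_eq_prod_automorphisms K y).trans ?_
    rw [Finset.prod_range]
    refine (hbij.prod_comp fun g => g y).symm.trans (Finset.prod_congr rfl fun i _ => ?_)
    rw [hpow]

theorem KM.l_norm_mul_l_eq_zero (hp : p.Prime)
    [hi : Fact (Irreducible (Polynomial.X ^ p - Polynomial.C a))]
    (y : AdjoinRoot (Polynomial.X ^ p - Polynomial.C a)) :
    KM.l (p := p) (Algebra.norm K y) * KM.l a = 0 := by
  have hm : (Polynomial.X ^ p - Polynomial.C a).Monic := Polynomial.monic_X_pow_sub_C a hp.ne_zero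
  have hfd : FiniteDimensional K (AdjoinRoot (Polynomial.X ^ p - Polynomial.C a)) :=
    hm.finite_adjoinRoot
  have hfr : Module.finrank K (AdjoinRoot (Polynomial.X ^ p - Polynomial.C a)) = p := by
    rw [(AdjoinRoot.powerBasis hm.ne_zero).finrank, AdjoinRoot.powerBasis_dim,
      Polynomial.natDegree_X_pow_sub_C]
  have hint : IsIntegral K (-y) := IsIntegral.of_finite K _
  have hdeg : (minpoly K (-y)).natDegree * Module.finrank K⟮-y⟯
      (AdjoinRoot (Polynomial.X ^ p - Polynomial.C a)) = p := by
    rw [← IntermediateField.adjoin.finrank hint, Module.finrank_mul_finrank, hfr]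
  rcases (Nat.dvd_prime hp).1 (Dvd.intro _ hdeg) with h | h
  · obtain ⟨c, hc⟩ := minpoly.natDegree_eq_one_iff.1 h
    have : y = algebraMap K _ (-c) := by rw [map_neg, hc, neg_neg]
    rw [this, Algebra.norm_algebraMap, hfr, KM.l_eq_zero_of_pow_eq rfl, zero_mul]
  · rw [h] at hdeg
    have h1 : Module.finrank K⟮-y⟯ (AdjoinRoot (Polynomial.X ^ p - Polynomial.C a)) = 1 :=
      Nat.eq_of_mul_eq_mul_left hp.pos (hdeg.trans (mul_one p).symm)
    have hnorm : Algebra.norm K y = (minpoly K (-y)).coeff 0 := by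
      have h2 := Algebra.norm_eq_norm_adjoin K (-y)
      have h3 := Algebra.PowerBasis.norm_gen_eq_coeff_zero_minpoly
        (IntermediateField.adjoin.powerBasis hint)
      rw [IntermediateField.adjoin.powerBasis_gen, IntermediateField.minpoly_gen,
        IntermediateField.adjoin.powerBasis_dim, h] at h3
      rw [h1, pow_one, h3] at h2
      have h4 : Algebra.norm K y = (-1) ^ p * Algebra.norm K (-y) := by
        have : y = algebraMap K _ (-1) * -y := by simp
        conv_lhs => rw [this]
        rw [map_mul, Algebra.norm_algebraMap, hfr]
      rw [h4, h2, ← mul_assoc, ← mul_pow]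
      simp
    rw [hnorm]
    have := Fact.mk (minpoly.irreducible hint)
    refine KM.l_coeff_zero_mul_eq_zero (minpoly.monic hint) ?_
    rw [KM.map_l]
    have htop : K⟮-y⟯ = ⊤ := IntermediateField.finrank_eq_one_iff_eq_top.1 h1
    have hmem : AdjoinRoot.root (Polynomial.X ^ p - Polynomial.C a) ∈ K⟮-y⟯ := by
      rw [htop]; trivial
    refine KM.l_eq_zero_of_pow_eq
      (x := (IntermediateField.adjoinRootEquivAdjoin K hint).symm ⟨_, hmem⟩) ?_
    rw [← map_pow, AlgEquiv.symm_apply_eq]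
    refine Subtype.ext ?_
    refine (root_X_pow_sub_C_pow p a).trans ?_
    exact (congrArg Subtype.val
      ((IntermediateField.adjoinRootEquivAdjoin K hint).commutes a)).symm

end Kummer

section Kummer

variable {K : Type*} [Field K] {p : ℕ} {ζ a : K}
  [hi : Fact (Irreducible (Polynomial.X ^ p - Polynomial.C a))]
  {σ : AdjoinRoot (Polynomial.X ^ p - Polynomial.C a) →+*
    AdjoinRoot (Polynomial.X ^ p - Polynomial.C a)}

theorem KM.l_mul_l_eq_zero_of_det [NeZero p] (hp : p.Prime) (hσ : IsKummerGenerator p ζ a σ) {b : K}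
    {x : Fin p → AdjoinRoot (Polynomial.X ^ p - Polynomial.C a)} (hx : x ≠ 0)
    (h : (cyclicMatrix σ (AdjoinRoot.of _ b) x).det = 0) :
    KM.l (p := p) a * KM.l b = 0 := by
  by_cases hb : b = 0
  · rw [hb, KM.l_zero, mul_zero]
  obtain ⟨r, hr0, hrp, δ, hδ⟩ :=
    exists_prod_eq_pow_of_det_eq_zero (hσ.map_of b) hσ.pow_eq_one hx h
  rw [← hσ.of_norm, ← map_pow] at hδ
  have h1 := KM.l_norm_mul_l_eq_zero hp δ
  have h2 : Algebra.norm K δ = b ^ r := (AdjoinRoot.of _).injective hδ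
  rw [h2, KM.l_pow hb, mul_assoc] at h1
  rw [KM.l_anticomm, KM.eq_zero_of_natCast_mul_eq_zero hp
    (fun hd => absurd (Nat.le_of_dvd hr0 hd) (not_le.2 hrp)) h1, neg_zero]

theorem IsKummerGenerator.exists_ringHom (hσ : IsKummerGenerator p ζ a σ)
    {E : Type*} [Field E] (i : K →+* E)
    {τ : AdjoinRoot (Polynomial.X ^ p - Polynomial.C (i a)) →+*
      AdjoinRoot (Polynomial.X ^ p - Polynomial.C (i a))}
    (hτ : IsKummerGenerator p (i ζ) (i a) τ) :
    ∃ φ : AdjoinRoot (Polynomial.X ^ p - Polynomial.C a) →+*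
        AdjoinRoot (Polynomial.X ^ p - Polynomial.C (i a)),
      (∀ c, φ (AdjoinRoot.of _ c) = AdjoinRoot.of _ (i c)) ∧ ∀ y, φ (σ y) = τ (φ y) := by
  have hroot : (Polynomial.X ^ p - Polynomial.C a).eval₂ ((AdjoinRoot.of _).comp i)
      (AdjoinRoot.root (Polynomial.X ^ p - Polynomial.C (i a))) = 0 := by
    rw [Polynomial.eval₂_sub, Polynomial.eval₂_X_pow, Polynomial.eval₂_C,
      root_X_pow_sub_C_pow]
    exact sub_self _
  let φ := AdjoinRoot.lift _ _ hroot
  have hof (c : K) : φ (AdjoinRoot.of _ c) = AdjoinRoot.of _ (i c) := AdjoinRoot.lift_of _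
  have hr : φ (AdjoinRoot.root _) = AdjoinRoot.root _ := AdjoinRoot.lift_root _
  refine ⟨φ, hof, fun y => ?_⟩
  have : φ.comp σ = τ.comp φ := by
    refine AdjoinRoot.ringHom_ext (RingHom.ext fun c => ?_) ?_
    · simp only [RingHom.comp_apply, hσ.map_of, hof, hτ.map_of]
    · simp only [RingHom.comp_apply, hσ.map_root, map_mul, hof, hr, hτ.map_root]
  exact DFunLike.congr_fun this y

theorem KM.l_coeff_zero_mul_eq_zero_of_monic {r : KM p K} {q : Polynomial K} (hq : q.Monic)
    (h0 : q.coeff 0 ≠ 0)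
    (h : ∀ π : Polynomial K, π.Monic → Irreducible π → π ∣ q → KM.l (π.coeff 0) * r = 0) :
    KM.l (q.coeff 0) * r = 0 := by
  induction hn : q.natDegree using Nat.strong_induction_on generalizing q with
  | _ n ih =>
    by_cases hu : IsUnit q
    · rw [hq.eq_one_of_isUnit hu, Polynomial.coeff_one_zero, KM.l_one, zero_mul]
    · obtain ⟨g, hg, hgi, s, rfl⟩ := Polynomial.exists_monic_irreducible_factor q hu
      have hs : s.Monic := hg.of_mul_monic_left hq
      rw [Polynomial.mul_coeff_zero] at h0 ⊢
      have hdeg : s.natDegree < n := by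
        rw [← hn, hg.natDegree_mul hs]
        have := hgi.natDegree_pos
        omega
      rw [KM.l_mul (left_ne_zero_of_mul h0) (right_ne_zero_of_mul h0), add_mul,
        h g hg hgi (dvd_mul_right _ _), zero_add]
      exact ih _ hdeg hs (right_ne_zero_of_mul h0)
        (fun π hπ hπi hd => h π hπ hπi (hd.mul_left _)) rfl

theorem IsKummerGenerator.exists_map_eq (hσ : IsKummerGenerator p ζ a σ)
    {Q : Polynomial (AdjoinRoot (Polynomial.X ^ p - Polynomial.C a))} (hQ : Q.map σ = Q) :
    ∃ q : Polynomial K, q.map (AdjoinRoot.of _) = Q := by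
  refine (Polynomial.mem_lifts _).1 ((Polynomial.lifts_iff_coeff_lifts _).2 fun n => ?_)
  exact hσ.exists_of_eq _ (by rw [← Polynomial.coeff_map, hQ])

theorem IsKummerGenerator.exists_charpoly [NeZero p] (hσ : IsKummerGenerator p ζ a σ) {b : K}
    (hb : b ≠ 0) (x : Fin p → AdjoinRoot (Polynomial.X ^ p - Polynomial.C a)) :
    ∃ q : Polynomial K, q.Monic ∧
      q.map (AdjoinRoot.of _) = (-cyclicMatrix σ (AdjoinRoot.of _ b) x).charpoly ∧
      AdjoinRoot.of _ (q.coeff 0) = (cyclicMatrix σ (AdjoinRoot.of _ b) x).det := by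
  obtain ⟨q, hq⟩ := hσ.exists_map_eq (charpoly_map_cyclicMatrix
    ((map_ne_zero_iff _ (AdjoinRoot.of _).injective).2 hb) (hσ.map_of b) hσ.pow_eq_one x)
  refine ⟨q, Polynomial.monic_of_injective (AdjoinRoot.of _).injective
    (hq ▸ Matrix.charpoly_monic _), hq, ?_⟩
  rw [← Polynomial.coeff_map, hq, Polynomial.coeff_zero_eq_eval_zero, Matrix.eval_charpoly]
  simp

theorem KM.l_det_mul_eq_zero [NeZero p] (hp : p.Prime) (hζ : IsPrimitiveRoot ζ p)
    (hσ : IsKummerGenerator p ζ a σ) {b : K} (hb : b ≠ 0)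
    (x : Fin p → AdjoinRoot (Polynomial.X ^ p - Polynomial.C a)) {v : K} (hv : v ≠ 0)
    (h : AdjoinRoot.of _ v = (cyclicMatrix σ (AdjoinRoot.of _ b) x).det) :
    KM.l (p := p) v * (KM.l a * KM.l b) = 0 := by
  by_cases hx : ∀ j, j ≠ 0 → x j = 0
  · have hx0 : x = Pi.single 0 (x 0) := by
      ext j
      by_cases hj : j = 0
      · rw [hj, Pi.single_eq_same]
      · rw [hx j hj, Pi.single_eq_of_ne hj]
    rw [hx0, cyclicMatrix_single, Matrix.det_diagonal,
      Fin.prod_univ_eq_prod_range (fun i => (σ ^ i) (x 0)), ← hσ.of_norm] at h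
    have h2 : v = Algebra.norm K (x 0) := (AdjoinRoot.of _).injective h
    rw [h2, ← mul_assoc, KM.l_norm_mul_l_eq_zero hp, zero_mul]
  push Not at hx
  obtain ⟨j, hj, hxj⟩ := hx
  obtain ⟨q, hqm, hq, hq0⟩ := hσ.exists_charpoly hb x
  obtain rfl : v = q.coeff 0 := (AdjoinRoot.of _).injective (h.trans hq0.symm)
  refine KM.l_coeff_zero_mul_eq_zero_of_monic hqm hv fun π hπ hπi hd => ?_
  have := Fact.mk hπi
  refine KM.l_coeff_zero_mul_eq_zero hπ ?_
  rw [map_mul, KM.map_l, KM.map_l]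
  by_cases hex : ∃ c, c ^ p = AdjoinRoot.of π a
  · obtain ⟨c, hc⟩ := hex
    rw [KM.l_eq_zero_of_pow_eq hc, zero_mul]
  push Not at hex
  have := Fact.mk (X_pow_sub_C_irreducible_of_prime hp hex)
  obtain ⟨τ, hτ⟩ := exists_isKummerGenerator (a := AdjoinRoot.of π a)
    (hζ.map_of_injective (AdjoinRoot.of π).injective)
  obtain ⟨φ, hφ, hφσ⟩ := hσ.exists_ringHom (AdjoinRoot.of π) hτ
  let ξ := AdjoinRoot.of (Polynomial.X ^ p - Polynomial.C (AdjoinRoot.of π a)) (AdjoinRoot.root π)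
  refine KM.l_mul_l_eq_zero_of_det hp hτ (x := φ ∘ x + Pi.single 0 ξ) (fun h0 => hxj ?_) ?_
  · have h1 := congrFun h0 j
    rw [Pi.add_apply, Pi.single_eq_of_ne hj, add_zero] at h1
    exact (map_eq_zero_iff φ φ.injective).1 h1
  · have hM := cyclicMatrix_map (AdjoinRoot.of _ b) φ hφσ x
    rw [hφ] at hM
    have hroot : q.eval₂ (AdjoinRoot.of π) (AdjoinRoot.root π) = 0 := by
      obtain ⟨s, rfl⟩ := hd
      rw [Polynomial.eval₂_mul, AdjoinRoot.eval₂_root, zero_mul]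
    have hev := congrArg (fun Q => (Q.map φ).eval ξ) hq
    have hcomp : φ.comp (AdjoinRoot.of _) = (AdjoinRoot.of _).comp (AdjoinRoot.of π) :=
      RingHom.ext hφ
    simp only [Polynomial.map_map, hcomp, ← Matrix.charpoly_map, Matrix.eval_charpoly] at hev
    rw [Polynomial.eval_map, ← Polynomial.hom_eval₂, hroot, map_zero] at hev
    rw [hev, cyclicMatrix_add, cyclicMatrix_single, ← hM]
    congr 1
    ext k l
    simp [ξ, Matrix.diagonal_apply, RingHom.pow_apply_of_apply_eq (hτ.map_of _), add_comm]

end Kummer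

/-- A form of degree `p` in `N` variables whose nonzero values are annihilated by `r`, and
which is anisotropic unless `r` vanishes. -/
def HasForm {K : Type*} [Field K] {p : ℕ} (r : KM p K) (N : ℕ) : Prop :=
  ∃ (ι : Type) (_ : Fintype ι) (f : (ι → K) → K), Fintype.card ι = N ∧ IsForm K p f ∧
    ∀ x ≠ 0, (f x = 0 → r = 0) ∧ (f x ≠ 0 → KM.l (f x) * r = 0)

namespace HasForm

variable {K : Type*} [Field K] {p N : ℕ}

theorem zero (p N : ℕ) : HasForm (0 : KM p K) N :=
  ⟨Fin N, inferInstance, fun _ => 0, Fintype.card_fin N, IsForm.zero,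
    fun _ _ => ⟨fun _ => rfl, fun _ => mul_zero _⟩⟩

theorem l_mul_l (hp : p.Prime) {ζ : K} (hζ : IsPrimitiveRoot ζ p) (a : K) {b : K} (hb : b ≠ 0) :
    HasForm (KM.l (p := p) a * KM.l b) (p ^ 2) := by
  by_cases hex : ∃ c, c ^ p = a
  · obtain ⟨c, hc⟩ := hex
    rw [KM.l_eq_zero_of_pow_eq hc, zero_mul]
    exact zero p _
  push Not at hex
  have := Fact.mk (X_pow_sub_C_irreducible_of_prime hp hex)
  have := NeZero.mk hp.ne_zero
  obtain ⟨σ, hσ⟩ := exists_isKummerGenerator (a := a) hζ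
  have hm : (Polynomial.X ^ p - Polynomial.C a).Monic := Polynomial.monic_X_pow_sub_C a hp.ne_zero
  let L := AdjoinRoot (Polynomial.X ^ p - Polynomial.C a)
  have hfd : FiniteDimensional K L := hm.finite_adjoinRoot
  have hfr : Module.finrank K L = p := by
    rw [(AdjoinRoot.powerBasis hm.ne_zero).finrank, AdjoinRoot.powerBasis_dim,
      Polynomial.natDegree_X_pow_sub_C]
  let B := Module.finBasisOfFinrankEq K L hfr
  let c (k : Fin p) : (Fin p × Fin p → K) →ₗ[K] L :=
    B.equivFun.symm.toLinearMap ∘ₗ LinearMap.funLeft K K (Prod.mk k)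
  have hc (x) (h : (fun k => c k x) = 0) : x = 0 := by
    ext ⟨k, j⟩
    exact congrFun (B.equivFun.symm.map_eq_zero_iff.1 (congrFun h k)) j
  let s (i : ℕ) : L →ₗ[K] L :=
    { toFun := fun y => (σ ^ i) y
      map_add' := map_add (σ ^ i)
      map_smul' := fun e y => by
        have h := RingHom.pow_apply_of_apply_eq (hσ.map_of e) i
        rw [Algebra.smul_def, Algebra.smul_def, map_mul, AdjoinRoot.algebraMap_eq, h]
        rfl }
  obtain ⟨Λ, hΛ⟩ := (Algebra.linearMap K L).exists_leftInverse_of_injective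
    (LinearMap.ker_eq_bot.2 (algebraMap K L).injective)
  have hdet : IsForm K (Fintype.card (Fin p) * 1) fun x =>
      (cyclicMatrix σ (AdjoinRoot.of _ b) fun k => c k x).det := by
    refine IsForm.det fun i j => ?_
    refine IsForm.sum Finset.univ
      (f := fun k x => s i (c k x) * (cyclicShift p (AdjoinRoot.of _ b) ^ (i : ℕ)) k j)
      fun k _ => ?_
    simp only [mul_comm (s i _)]
    exact (IsForm.linear (s i ∘ₗ c k)).const_mul _
  rw [Fintype.card_fin, mul_one] at hdet
  have hof (x) : AdjoinRoot.of _ (Λ (cyclicMatrix σ (AdjoinRoot.of _ b) fun k => c k x).det) =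
      (cyclicMatrix σ (AdjoinRoot.of _ b) fun k => c k x).det := by
    obtain ⟨q, -, -, hq⟩ := hσ.exists_charpoly hb fun k => c k x
    rw [← hq]
    exact congrArg _ (DFunLike.congr_fun hΛ (q.coeff 0))
  refine ⟨Fin p × Fin p, inferInstance, _, by simp [sq], hdet.linear_comp Λ, fun x hx =>
    ⟨fun h => ?_, fun h => ?_⟩⟩
  · refine KM.l_mul_l_eq_zero_of_det hp hσ (x := fun k => c k x) (fun h0 => hx (hc x h0)) ?_
    rw [← hof, h, map_zero]
  · exact KM.l_det_mul_eq_zero hp hζ hσ hb _ h (hof x)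

theorem l_mul (hp : p.Prime) {r : KM p K} (h : HasForm r N) {c : K} (hc : c ≠ 0) :
    HasForm (KM.l c * r) (2 * N) := by
  by_cases hr : r = 0
  · rw [hr, mul_zero]
    exact zero p _
  obtain ⟨ι, _, f, hN, ⟨P, hP, eP⟩, hf⟩ := h
  have h0 : f 0 = 0 := by
    have : eval 0 P = 0 := by
      rw [eval_zero, constantCoeff_eq]
      exact hP.coeff_eq_zero (by simpa using hp.ne_zero.symm)
    simpa [eP] using this
  have hf0 {x} (hx : f x ≠ 0) : KM.l (f x) * r = 0 :=
    (hf x fun h => hx (h ▸ h0)).2 hx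
  have hform (e : ι → ι ⊕ ι) : IsForm K p fun x : ι ⊕ ι → K => f (x ∘ e) :=
    ⟨rename e P, hP.rename_isHomogeneous, fun x => by
      rw [eval_rename]
      exact eP _⟩
  refine ⟨ι ⊕ ι, inferInstance, fun x => f (x ∘ Sum.inl) - c * f (x ∘ Sum.inr), ?_,
    (hform _).sub ((hform _).const_mul c), fun x hx => ?_⟩
  · rw [Fintype.card_sum, hN, two_mul]
  have han {y} (hy : f y = 0) : y = 0 := by_contra fun h => hr ((hf y h).1 hy)
  beta_reduce
  by_cases hu : f (x ∘ Sum.inl) = 0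
  · have hv : f (x ∘ Sum.inr) ≠ 0 := fun hv => hx <| by
      rw [← Sum.elim_comp_inl_inr x, han hu, han hv, Sum.elim_zero_zero]
    rw [hu, zero_sub]
    refine ⟨fun h => absurd h (neg_ne_zero.2 (mul_ne_zero hc hv)), fun _ => ?_⟩
    rw [← neg_mul, KM.l_mul (neg_ne_zero.2 hc) hv, add_mul, ← mul_assoc, ← mul_assoc,
      KM.l_anticomm, KM.l_mul_l_neg hc, KM.l_anticomm, neg_mul, neg_mul, mul_assoc, hf0 hv]
    simp
  by_cases hv : f (x ∘ Sum.inr) = 0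
  · rw [hv, mul_zero, sub_zero]
    refine ⟨fun h => absurd h hu, fun _ => ?_⟩
    rw [← mul_assoc, KM.l_anticomm, neg_mul, mul_assoc, hf0 hu, mul_zero, neg_zero]
  have hur := hf0 hu
  have hvr := hf0 hv
  generalize f (x ∘ Sum.inl) = u at hu hur ⊢
  generalize f (x ∘ Sum.inr) = v at hv hvr ⊢
  have hcv : KM.l (p := p) (c * v) * r = KM.l c * r := by
    rw [KM.l_mul hc hv, add_mul, hvr, add_zero]
  refine ⟨fun h => ?_, fun h => ?_⟩
  · rw [← hcv, ← sub_eq_zero.1 h, hur]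
  · have hs := KM.l_steinberg (p := p) h (mul_ne_zero hc hv) (by rwa [sub_add_cancel])
    rw [sub_add_cancel] at hs
    have huc : KM.l u * (KM.l c * r) = 0 := by
      rw [← mul_assoc, KM.l_anticomm, neg_mul, mul_assoc, hur, mul_zero, neg_zero]
    have := congrArg (· * r) hs
    simpa only [mul_assoc, sub_mul, mul_sub, hur, hcv, huc, zero_mul, mul_zero, sub_zero] using this

theorem list_prod (hp : p.Prime) {ζ : K} (hζ : IsPrimitiveRoot ζ p) (s : List K)
    (hs : ∀ x ∈ s, x ≠ 0) {k : ℕ} (hk : s.length = k + 2) :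
    HasForm (s.map (KM.l (p := p))).prod (p ^ 2 * 2 ^ k) := by
  induction k generalizing s with
  | zero =>
    obtain ⟨a, b, rfl⟩ := List.length_eq_two.1 hk
    simpa using l_mul_l hp hζ a (hs b (by simp))
  | succ k ih =>
    obtain ⟨a, s, rfl⟩ := List.exists_cons_of_length_eq_add_one hk
    have := (ih s (fun x hx => hs x (List.mem_cons_of_mem _ hx)) (by simpa using hk)).l_mul hp
      (hs a List.mem_cons_self)
    rwa [← List.prod_cons, ← List.map_cons, mul_left_comm, ← pow_succ'] at this

theorem eq_zero_of_isCField {F : Type u} [Field F] {n : ℕ} (hC : IsCField F n) [Algebra F K]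
    [FiniteDimensional F K] (hp : p.Prime) {r : KM p K} (h : HasForm r N) (hN : p ^ n < N) :
    r = 0 := by
  obtain ⟨ι, _, f, rfl, hform, hf⟩ := h
  by_contra hr
  exact hN.not_ge (hC.card_le_of_finite hp.pos hform fun x hx =>
    by_contra fun h0 => hr ((hf x h0).1 hx))

end HasForm

theorem exists_irreducible_isPrimitiveRoot (F : Type*) [Field F] {p : ℕ} (hp : p.Prime)
    (hF : (p : F) ≠ 0) :
    ∃ π : Polynomial F, π.Monic ∧ Irreducible π ∧ ¬ p ∣ π.natDegree ∧
      IsPrimitiveRoot (AdjoinRoot.root π) p := by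
  have hdeg := Polynomial.natDegree_cyclotomic p F
  rw [Nat.totient_prime hp] at hdeg
  have h2 := hp.two_le
  have hu : ¬ IsUnit (Polynomial.cyclotomic p F) := fun h => by
    rw [(Polynomial.cyclotomic.monic p F).eq_one_of_isUnit h, Polynomial.natDegree_one] at hdeg
    omega
  obtain ⟨π, hπ, hπi, hd⟩ := Polynomial.exists_monic_irreducible_factor _ hu
  refine ⟨π, hπ, hπi, fun h => ?_, ?_⟩
  · have h1 := Nat.le_of_dvd hπi.natDegree_pos h
    have h3 := Polynomial.natDegree_le_of_dvd hd (Polynomial.cyclotomic_ne_zero p F)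
    omega
  · have := Fact.mk hπi
    have : NeZero (p : AdjoinRoot π) :=
      ⟨by rwa [← map_natCast (AdjoinRoot.of π), map_ne_zero_iff _ (AdjoinRoot.of π).injective]⟩
    rw [← Polynomial.isRoot_cyclotomic_iff, ← Polynomial.map_cyclotomic p (AdjoinRoot.of π),
      Polynomial.IsRoot, Polynomial.eval_map]
    obtain ⟨s, hs⟩ := hd
    rw [hs, Polynomial.eval₂_mul, AdjoinRoot.eval₂_root, zero_mul]

theorem pow_lt_of_zpow_lt {p n m : ℕ} (hp : 0 < p)
    (h : (p : ℚ) ^ ((n : ℤ) - 2) < (2 : ℚ) ^ (((m + 1 : ℕ) : ℤ) - 1)) :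
    p ^ n < p ^ 2 * 2 ^ m := by
  have hp' : (0 : ℚ) < p := by exact_mod_cast hp
  rw [zpow_sub₀ hp'.ne', Nat.cast_add_one, add_sub_cancel_right] at h
  rw [div_lt_iff₀ (by positivity), mul_comm] at h
  exact_mod_cast h

/-- If `F` has the `C_n` property, `p` is a prime not equal
to the characteristic of `F`, and `m` is a positive integer with
`2 ^ (m - 1) > p ^ (n - 2)` (as real exponents), then
`K_{m+1}^M(F)/pK_{m+1}^M(F) = 0`. -/
theorem kMod_p_bound (F : Type u) [Field F] (p : ℕ) (hp : p.Prime) (n m : ℕ)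
    (hchar : ringChar F ≠ p) (hC : IsCField F n) (hm : 0 < m)
    (hbound : (p : ℚ) ^ ((n : ℤ) - 2) < (2 : ℚ) ^ ((m : ℤ) - 1)) :
    ∀ α : kMod F p (m + 1), α = 0 := by
  obtain ⟨m, rfl⟩ := Nat.exists_eq_add_one.2 hm
  have hF : (p : F) ≠ 0 := fun h =>
    ((Nat.dvd_prime hp).1 ((ringChar.spec F p).1 h)).elim (CharP.ringChar_ne_one) hchar
  obtain ⟨π, hπ, hπi, hdeg, hζ⟩ := exists_irreducible_isPrimitiveRoot F hp hF
  have := Fact.mk hπi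
  have := hπ.finite_adjoinRoot
  refine kMod.eq_zero_of_symbol fun a => kMod.symbol_eq_zero a ?_
  refine KM.eq_zero_of_natCast_mul_eq_zero hp hdeg (KM.natDegree_mul_eq_zero hπ ?_)
  rw [map_list_prod, List.map_ofFn]
  have := HasForm.list_prod hp hζ (List.ofFn fun i => AdjoinRoot.of π (a i))
    (by simp [List.mem_ofFn]) (k := m) (by simp)
  rw [List.map_ofFn] at this
  refine Eq.trans ?_ (this.eq_zero_of_isCField hC hp (pow_lt_of_zpow_lt hp.pos hbound))
  congr 2
  funext i
  exact KM.map_l _ _ _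
end

section
/- Let F be a field, p a prime not equal to the characteristic of F, β ∈ k_n(F), a ∈ F*, and set α = β ∪ (a) ∈ k_{n+1}(F). Suppose N is a homogeneous form of degree p on a finite-dimensional F-vector space V which neutralizes β and splits β. Then the form N' = N ⊕ (−a)N on V ⊕ V, defined by N'(v, w) = N(v) − a·N(w), both splits α and neutralizes α. -/
universe u

open MvPolynomial

variable (F : Type u) [Field F]

section Res

variable (L : Type u) [Field L] [Algebra F L]

/-- The map on free abelian groups induced by extension of scalars on units. -/
def freeRes (n : ℕ) : FreeAbelianGroup (Fin n → Fˣ) →+ FreeAbelianGroup (Fin n → Lˣ) :=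
  FreeAbelianGroup.map (fun a => (Units.map (algebraMap F L).toMonoidHom) ∘ a)

theorem milnorRel_le_comap (n : ℕ) :
    milnorRel F n ≤ (milnorRel L n).comap (freeRes F L n) := by
  rw [milnorRel, AddSubgroup.closure_le]
  rintro z (⟨a, i, u, v, hai, rfl⟩ | ⟨a, i, j, hij, hsum, rfl⟩)
  · show freeRes F L n _ ∈ milnorRel L n
    rw [map_sub, map_sub, freeRes, FreeAbelianGroup.map_of_apply,
      FreeAbelianGroup.map_of_apply, FreeAbelianGroup.map_of_apply]
    refine AddSubgroup.subset_closure (Or.inl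
      ⟨(Units.map (algebraMap F L).toMonoidHom) ∘ a, i,
        Units.map (algebraMap F L).toMonoidHom u,
        Units.map (algebraMap F L).toMonoidHom v, by simp [hai], ?_⟩)
    rw [Function.comp_update, Function.comp_update]
  · show freeRes F L n _ ∈ milnorRel L n
    rw [freeRes, FreeAbelianGroup.map_of_apply]
    refine AddSubgroup.subset_closure (Or.inr
      ⟨(Units.map (algebraMap F L).toMonoidHom) ∘ a, i, j, hij, ?_, rfl⟩)
    simp only [Function.comp_apply, Units.coe_map, RingHom.toMonoidHom_eq_coe,
      MonoidHom.coe_coe]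
    rw [← map_add, hsum, map_one]

/-- Restriction `K_n^M(F) → K_n^M(L)`. -/
def resMilnor (n : ℕ) : MilnorK F n →+ MilnorK L n :=
  QuotientAddGroup.map _ _ (freeRes F L n) (milnorRel_le_comap F L n)

theorem pMul_le_comap (p n : ℕ) :
    pMul F p n ≤ (pMul L p n).comap (resMilnor F L n) := by
  rw [pMul, AddSubgroup.closure_le]
  rintro z ⟨y, rfl⟩
  exact AddSubgroup.subset_closure ⟨resMilnor F L n y, by rw [map_nsmul]⟩

/-- Restriction `k_n(F) → k_n(L)`. -/
def resK (p n : ℕ) : kMod F p n →+ kMod L p n :=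
  QuotientAddGroup.map _ _ (resMilnor F L n) (pMul_le_comap F L p n)

end Res

section Cup

/-- The map on free abelian groups appending a fixed unit `c` to a tuple. -/
def freeCup {n : ℕ} (c : Fˣ) :
    FreeAbelianGroup (Fin n → Fˣ) →+ FreeAbelianGroup (Fin (n + 1) → Fˣ) :=
  FreeAbelianGroup.map (fun a => Fin.snoc a c)

theorem milnorRel_le_comap_cup (n : ℕ) (c : Fˣ) :
    milnorRel F n ≤ (milnorRel F (n + 1)).comap (freeCup F c) := by
  rw [milnorRel, AddSubgroup.closure_le]
  rintro z (⟨a, i, u, v, hai, rfl⟩ | ⟨a, i, j, hij, hsum, rfl⟩)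
  · show freeCup F c _ ∈ milnorRel F (n + 1)
    rw [map_sub, map_sub, freeCup, FreeAbelianGroup.map_of_apply,
      FreeAbelianGroup.map_of_apply, FreeAbelianGroup.map_of_apply]
    refine AddSubgroup.subset_closure (Or.inl
      ⟨Fin.snoc a c, i.castSucc, u, v, by rw [Fin.snoc_castSucc, hai], ?_⟩)
    rw [Fin.snoc_update, Fin.snoc_update]
  · show freeCup F c _ ∈ milnorRel F (n + 1)
    rw [freeCup, FreeAbelianGroup.map_of_apply]
    refine AddSubgroup.subset_closure
      (Or.inr ⟨Fin.snoc a c, i.castSucc, j.castSucc, by simpa using hij, ?_, rfl⟩)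
    rw [Fin.snoc_castSucc, Fin.snoc_castSucc]
    exact hsum

/-- Cup product with a unit, `K_n^M(F) → K_{n+1}^M(F)`. -/
def cupMilnor {n : ℕ} (c : Fˣ) : MilnorK F n →+ MilnorK F (n + 1) :=
  QuotientAddGroup.map _ _ (freeCup F c) (milnorRel_le_comap_cup F n c)

theorem pMul_le_comap_cup (p n : ℕ) (c : Fˣ) :
    pMul F p n ≤ (pMul F p (n + 1)).comap (cupMilnor F (n := n) c) := by
  rw [pMul, AddSubgroup.closure_le]
  rintro z ⟨y, rfl⟩
  exact AddSubgroup.subset_closure ⟨cupMilnor F c y, by rw [map_nsmul]⟩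

/-- Cup product with the class of a unit, `k_n(F) → k_{n+1}(F)`;
on symbols it is given by `(a_1, …, a_n) ∪ (c) = (a_1, …, a_n, c)`. -/
def cupUnit (p : ℕ) {n : ℕ} (c : Fˣ) : kMod F p n →+ kMod F p (n + 1) :=
  QuotientAddGroup.map _ _ (cupMilnor F c) (pMul_le_comap_cup F p n c)

end Cup

section Forms

variable {ι : Type} [Fintype ι]

/-- A form `N` splits a class `α ∈ k_n(F)` if for every field extension `L/F`,
isotropy of `N` over `L` implies that `α` becomes trivial in `k_n(L)`. -/
def SplitsClass (p : ℕ) (N : MvPolynomial ι F) {n : ℕ} (α : kMod F p n) : Prop :=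
  ∀ (L : Type u) [Field L] [Algebra F L],
    (∃ x : ι → L, x ≠ 0 ∧ MvPolynomial.aeval x N = 0) → resK F L p n α = 0

/-- A form `N` neutralizes a class `α ∈ k_n(F)` if for every field extension
`L/F` and every `x` with `N(x) ≠ 0`, the class `α_L ∪ (N(x))` vanishes. -/
def NeutralizesClass (p : ℕ) (N : MvPolynomial ι F) {n : ℕ} (α : kMod F p n) : Prop :=
  ∀ (L : Type u) [Field L] [Algebra F L] (x : ι → L) (h : MvPolynomial.aeval x N ≠ 0),
    cupUnit L p (Units.mk0 (MvPolynomial.aeval x N) h) (resK F L p n α) = 0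

end Forms

theorem kMod_hom_ext {K : Type u} [Field K] {p n : ℕ} {A : Type u} [AddCommGroup A]
    {f g : kMod K p n →+ A} (h : ∀ a : Fin n → Kˣ, f (symbol K p a) = g (symbol K p a)) :
    f = g := by
  have hfree : (f.comp (QuotientAddGroup.mk' (pMul K p n))).comp
      (QuotientAddGroup.mk' (milnorRel K n)) =
      (g.comp (QuotientAddGroup.mk' (pMul K p n))).comp
      (QuotientAddGroup.mk' (milnorRel K n)) :=
    FreeAbelianGroup.lift_ext _ _ h
  ext x
  obtain ⟨y, rfl⟩ := QuotientAddGroup.mk_surjective x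
  obtain ⟨z, rfl⟩ := QuotientAddGroup.mk_surjective y
  exact DFunLike.congr_fun hfree z

theorem cupUnit_symbol {K : Type u} [Field K] (p : ℕ) {n : ℕ} (c : Kˣ) (a : Fin n → Kˣ) :
    cupUnit K p c (symbol K p a) = symbol K p (Fin.snoc a c : Fin (n + 1) → Kˣ) :=
  rfl

theorem resK_symbol {K : Type u} [Field K] (L : Type u) [Field L] [Algebra K L] (p : ℕ) {n : ℕ}
    (a : Fin n → Kˣ) :
    resK K L p n (symbol K p a) =
      symbol L p (Units.map (algebraMap K L).toMonoidHom ∘ a) :=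
  rfl

theorem symbol_eq_add {K : Type u} [Field K] (p : ℕ) {n : ℕ} (a : Fin n → Kˣ) (i : Fin n)
    {u v : Kˣ} (h : a i = u * v) :
    symbol K p a =
      symbol K p (Function.update a i u) + symbol K p (Function.update a i v) := by
  have hrel : FreeAbelianGroup.of a - FreeAbelianGroup.of (Function.update a i u)
      - FreeAbelianGroup.of (Function.update a i v) ∈ milnorRel K n :=
    AddSubgroup.subset_closure (Or.inl ⟨a, i, u, v, h, rfl⟩)
  have hmk := congrArg (QuotientAddGroup.mk' (pMul K p n))
    ((QuotientAddGroup.eq_zero_iff _).mpr hrel)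
  rw [← sub_eq_zero, ← sub_sub]
  exact hmk

theorem symbol_eq_zero {K : Type u} [Field K] (p : ℕ) {n : ℕ} (a : Fin n → Kˣ) (i j : Fin n)
    (hij : (i : ℕ) + 1 = j) (h : (a i : K) + a j = 1) : symbol K p a = 0 :=
  congrArg (QuotientAddGroup.mk' (pMul K p n))
    ((QuotientAddGroup.eq_zero_iff _).mpr
      (AddSubgroup.subset_closure (Or.inr ⟨a, i, j, hij, h, rfl⟩)))

theorem resK_cupUnit {K : Type u} [Field K] (L : Type u) [Field L] [Algebra K L] (p : ℕ) {n : ℕ}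
    (c : Kˣ) (x : kMod K p n) :
    resK K L p (n + 1) (cupUnit K p c x) =
      cupUnit L p (Units.map (algebraMap K L).toMonoidHom c) (resK K L p n x) := by
  refine DFunLike.congr_fun (f := (resK K L p (n + 1)).comp (cupUnit K p c))
    (g := (cupUnit L p (Units.map (algebraMap K L).toMonoidHom c)).comp (resK K L p n))
    (kMod_hom_ext fun a => ?_) x
  simp only [AddMonoidHom.comp_apply, cupUnit_symbol, resK_symbol, Fin.comp_snoc]

theorem cupUnit_mul {K : Type u} [Field K] (p : ℕ) {n : ℕ} (u v : Kˣ) (x : kMod K p n) :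
    cupUnit K p (u * v) x = cupUnit K p u x + cupUnit K p v x := by
  refine DFunLike.congr_fun (f := cupUnit K p (u * v)) (g := cupUnit K p u + cupUnit K p v)
    (kMod_hom_ext fun a => ?_) x
  simp only [AddMonoidHom.add_apply, cupUnit_symbol]
  rw [symbol_eq_add p _ (Fin.last n) (Fin.snoc_last _ _), Fin.update_snoc_last,
    Fin.update_snoc_last]

theorem cupUnit_cupUnit_of_add_eq_one {K : Type u} [Field K] (p : ℕ) {n : ℕ} {u v : Kˣ}
    (h : (u : K) + v = 1) (x : kMod K p n) :
    cupUnit K p v (cupUnit K p u x) = 0 := by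
  refine DFunLike.congr_fun (f := (cupUnit K p v).comp (cupUnit K p u)) (g := 0)
    (kMod_hom_ext fun a => ?_) x
  simp only [AddMonoidHom.comp_apply, cupUnit_symbol, AddMonoidHom.zero_apply]
  refine symbol_eq_zero p _ (Fin.last n).castSucc (Fin.last (n + 1)) (by simp) ?_
  rw [Fin.snoc_castSucc, Fin.snoc_last, Fin.snoc_last]
  exact h

theorem cupUnit_one {K : Type u} [Field K] (p : ℕ) {n : ℕ} (x : kMod K p n) :
    cupUnit K p 1 x = 0 := by
  simpa using cupUnit_mul p 1 1 x

theorem cupUnit_inv {K : Type u} [Field K] (p : ℕ) {n : ℕ} (u : Kˣ) (x : kMod K p n) :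
    cupUnit K p u⁻¹ x = -cupUnit K p u x := by
  rw [eq_neg_iff_add_eq_zero, ← cupUnit_mul, inv_mul_cancel, cupUnit_one]

theorem cupUnit_neg_cupUnit_self {K : Type u} [Field K] (p : ℕ) {n : ℕ} (u : Kˣ)
    (x : kMod K p n) : cupUnit K p (-u) (cupUnit K p u x) = 0 := by
  by_cases hu : u = 1
  · rw [hu, cupUnit_one, map_zero]
  have hu0 : (u : K) ≠ 0 := u.ne_zero
  have hu1 : 1 - (u : K) ≠ 0 := fun h => hu (Units.ext (sub_eq_zero.mp h).symm)
  have hv1 : 1 - (u : K)⁻¹ ≠ 0 := fun h => hu (Units.ext (by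
    simpa using (sub_eq_zero.mp h).symm))
  have hfac : -u * Units.mk0 _ hv1 = Units.mk0 _ hu1 := by
    ext
    simp only [Units.val_mul, Units.val_neg, Units.val_mk0]
    field_simp
    ring
  have hsum := cupUnit_mul p (-u) (Units.mk0 _ hv1) (cupUnit K p u x)
  have hinv : cupUnit K p (Units.mk0 _ hv1) (cupUnit K p u⁻¹ x) = 0 :=
    cupUnit_cupUnit_of_add_eq_one p (by simp) x
  rw [cupUnit_inv, map_neg, neg_eq_zero] at hinv
  rw [hfac, hinv, add_zero, cupUnit_cupUnit_of_add_eq_one p (by simp) x] at hsum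
  exact hsum.symm

theorem cupUnit_cupUnit_comm {K : Type u} [Field K] (p : ℕ) {n : ℕ} (u v : Kˣ)
    (x : kMod K p n) :
    cupUnit K p u (cupUnit K p v x) = -cupUnit K p v (cupUnit K p u x) := by
  have h := cupUnit_neg_cupUnit_self p (u * v) x
  have hu := cupUnit_neg_cupUnit_self p u x
  have hv := cupUnit_neg_cupUnit_self p v x
  have hneg (w y : Kˣ) (z : kMod K p (n + 1)) :
      cupUnit K p (-(w * y)) z = cupUnit K p (-w) z + cupUnit K p y z := by
    rw [← neg_mul, cupUnit_mul]
  rw [cupUnit_mul, map_add, hneg, mul_comm u v, hneg, hu, hv, zero_add, zero_add] at h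
  exact eq_neg_of_add_eq_zero_right h

theorem aeval_rename_sub_C_mul_rename {K L ι : Type*} [CommRing K] [CommRing L] [Algebra K L]
    (N : MvPolynomial ι K) (a : K) (x : ι ⊕ ι → L) :
    aeval x (rename Sum.inl N - C a * rename Sum.inr N) =
      aeval (x ∘ Sum.inl) N - algebraMap K L a * aeval (x ∘ Sum.inr) N := by
  rw [map_sub, map_mul, aeval_rename, aeval_rename, aeval_C]

/-- Let `p` be a prime different from the characteristic of
`F`, `β ∈ k_n(F)`, `a ∈ F^*` and `α = β ∪ (a) ∈ k_{n+1}(F)`.  If `N` is a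
degree-`p` homogeneous form on a finite-dimensional `F`-vector space which
neutralizes and splits `β`, then the form `N' = N ⊕ (-a)N`, given by
`N'(v, w) = N(v) - a·N(w)`, splits and neutralizes `α`. -/
theorem norm_doubling (F : Type u) [Field F] (p : ℕ) (hp : p.Prime)
    (hchar : ringChar F ≠ p) (n : ℕ) (β : kMod F p n) (a : Fˣ)
    (d : ℕ) (N : MvPolynomial (Fin d) F) (hdeg : N.IsHomogeneous p)
    (hneut : NeutralizesClass F p N β) (hsplit : SplitsClass F p N β) :
    SplitsClass F p
        (MvPolynomial.rename Sum.inl N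
          - MvPolynomial.C (a : F) * MvPolynomial.rename Sum.inr N)
        (cupUnit F p a β) ∧
    NeutralizesClass F p
        (MvPolynomial.rename Sum.inl N
          - MvPolynomial.C (a : F) * MvPolynomial.rename Sum.inr N)
        (cupUnit F p a β) := by
  let aL (L : Type u) [Field L] [Algebra F L] : Lˣ :=
    Units.map (algebraMap F L).toMonoidHom a
  refine ⟨fun L _ _ ⟨x, hx, hx0⟩ => ?_, fun L _ _ x h => ?_⟩
  · rw [aeval_rename_sub_C_mul_rename, sub_eq_zero] at hx0
    rw [resK_cupUnit]
    by_cases hw : aeval (x ∘ Sum.inr) N = 0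
    · rw [hw, mul_zero] at hx0
      have hβ : resK F L p n β = 0 := by
        by_cases hv : x ∘ Sum.inl = 0
        · refine hsplit L ⟨x ∘ Sum.inr, fun hr => hx ?_, hw⟩
          ext (i | i)
          exacts [congrFun hv i, congrFun hr i]
        · exact hsplit L ⟨_, hv, hx0⟩
      rw [hβ, map_zero]
    · have ha := (map_ne_zero (algebraMap F L)).mpr a.ne_zero
      have hv : aeval (x ∘ Sum.inl) N ≠ 0 := hx0 ▸ mul_ne_zero ha hw
      have hfac : Units.mk0 _ hv = aL L * Units.mk0 _ hw := Units.ext hx0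
      have hmul := cupUnit_mul p (aL L) (Units.mk0 _ hw) (resK F L p n β)
      rwa [← hfac, hneut, hneut, add_zero, eq_comm] at hmul
  · have hN := aeval_rename_sub_C_mul_rename (L := L) N (a : F) x
    generalize hc : Units.mk0 _ h = c
    have hcL : (c : L) = aeval (x ∘ Sum.inl) N - aL L * aeval (x ∘ Sum.inr) N := by
      rw [← hc]
      exact hN
    rw [resK_cupUnit]
    change cupUnit L p c (cupUnit L p (aL L) (resK F L p n β)) = 0
    have hswap (u : Lˣ) (hu : cupUnit L p u (resK F L p n β) = 0) :
        cupUnit L p u (cupUnit L p (aL L) (resK F L p n β)) = 0 := by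
      rw [cupUnit_cupUnit_comm, hu, map_zero, neg_zero]
    by_cases hw : aeval (x ∘ Sum.inr) N = 0
    · have hv : aeval (x ∘ Sum.inl) N ≠ 0 := by simpa [hw] using hcL.symm.trans_ne c.ne_zero
      have hcv : c = Units.mk0 _ hv := Units.ext (by simpa [hw] using hcL)
      exact hswap c (hcv ▸ hneut L _ hv)
    by_cases hv : aeval (x ∘ Sum.inl) N = 0
    · have hcw : c = -(aL L) * Units.mk0 _ hw := Units.ext (by simpa [hv] using hcL)
      rw [hcw, cupUnit_mul, cupUnit_neg_cupUnit_self, hswap _ (hneut L _ hw), add_zero]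
    set v := Units.mk0 _ hv
    set w := Units.mk0 _ hw
    set t := aL L * (w * v⁻¹) with ht
    have hct : (t : L) + ↑(c * v⁻¹) = 1 := by
      have hvv : (v : L) = aeval (x ∘ Sum.inl) N := rfl
      have hww : (w : L) = aeval (x ∘ Sum.inr) N := rfl
      rw [Units.val_mul c, hcL, ← hvv, ← hww, ht]
      push_cast
      have := v.ne_zero
      field_simp
      ring
    have hta : cupUnit L p t (resK F L p n β) = cupUnit L p (aL L) (resK F L p n β) := by
      rw [ht, cupUnit_mul, cupUnit_mul, cupUnit_inv, hneut L _ hv, hneut L _ hw, neg_zero,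
        add_zero, add_zero]
    have hcv := cupUnit_mul p (c * v⁻¹) v (cupUnit L p (aL L) (resK F L p n β))
    rw [inv_mul_cancel_right, hswap v (hneut L _ hv), ← hta,
      cupUnit_cupUnit_of_add_eq_one p hct, add_zero, hta] at hcv
    exact hcv
end

section
/- Let F be a field, p a prime not equal to the characteristic of F, and a_1, …, a_n ∈ F*. If there exist r_1, …, r_n ∈ F, not all zero, with a_1 r_1^p + ⋯ + a_n r_n^p = 0, then the symbol (a_1, …, a_n) is trivial in k_n(F) = K_n^M(F)/pK_n^M(F). Consequently the diagonal degree-p form a_1 t_1^p + ⋯ + a_n t_n^p splits the symbol (a_1, …, a_n). -/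
universe u

open MvPolynomial

variable (F : Type u) [Field F]

section SteinbergSymbols

variable {F} {A : Type*} [AddCommGroup A]

/-- A bimultiplicative map on units which vanishes on pairs of units summing to `1`. -/
structure IsSteinbergSymbol (f : Fˣ → Fˣ → A) : Prop where
  mul_left : ∀ x y z, f (x * y) z = f x z + f y z
  mul_right : ∀ x y z, f x (y * z) = f x y + f x z
  eq_zero_of_add_eq_one : ∀ x y : Fˣ, (x : F) + y = 1 → f x y = 0

namespace IsSteinbergSymbol

variable {f : Fˣ → Fˣ → A}

theorem one_left (hf : IsSteinbergSymbol f) (z : Fˣ) : f 1 z = 0 := by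
  simpa using hf.mul_left 1 1 z

theorem one_right (hf : IsSteinbergSymbol f) (z : Fˣ) : f z 1 = 0 := by
  simpa using hf.mul_right z 1 1

theorem inv_left (hf : IsSteinbergSymbol f) (x z : Fˣ) : f x⁻¹ z = -f x z := by
  rw [eq_neg_iff_add_eq_zero, ← hf.mul_left, inv_mul_cancel, hf.one_left]

theorem inv_right (hf : IsSteinbergSymbol f) (x z : Fˣ) : f x z⁻¹ = -f x z := by
  rw [eq_neg_iff_add_eq_zero, ← hf.mul_right, inv_mul_cancel, hf.one_right]

theorem neg_self (hf : IsSteinbergSymbol f) (x : Fˣ) : f x (-x) = 0 := by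
  by_cases hx : x = 1
  · rw [hx, hf.one_left]
  have hx' : (x : F) ≠ 1 := fun h => hx (Units.ext h)
  have hx0 : (x : F) ≠ 0 := x.ne_zero
  have h₁ : 1 - (x : F) ≠ 0 := sub_ne_zero.2 hx'.symm
  have h₂ : 1 - (x : F)⁻¹ ≠ 0 := sub_ne_zero.2 fun h => hx' (inv_eq_one.1 h.symm)
  have key : -x = Units.mk0 _ h₁ * (Units.mk0 _ h₂)⁻¹ := by
    rw [eq_mul_inv_iff_mul_eq]
    ext
    simp only [Units.val_mul, Units.val_neg, Units.val_mk0]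
    field_simp
    ring
  have h₃ : f x⁻¹ (Units.mk0 _ h₂) = 0 := hf.eq_zero_of_add_eq_one _ _ (by simp)
  rw [key, hf.mul_right, hf.eq_zero_of_add_eq_one x _ (by simp), hf.inv_right, ← hf.inv_left,
    h₃, add_zero]

theorem eq_neg_swap (hf : IsSteinbergSymbol f) (x y : Fˣ) : f x y = -f y x := by
  have h := hf.neg_self (x * y)
  rw [hf.mul_left, ← neg_mul, hf.mul_right, hf.neg_self, zero_add, neg_mul, ← mul_neg,
    hf.mul_right, hf.neg_self, add_zero] at h
  exact eq_neg_of_add_eq_zero_left h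

theorem eq_of_add_eq (hf : IsSteinbergSymbol f) {x y c : Fˣ} (h : (x : F) + y = c) :
    f x y = f x c + f c y - f c c := by
  have key := hf.eq_zero_of_add_eq_one (x * c⁻¹) (y * c⁻¹) (by
    rw [Units.val_mul, Units.val_mul, ← add_mul, h, ← Units.val_mul, mul_inv_cancel,
      Units.val_one])
  simp only [hf.mul_left, hf.mul_right, hf.inv_left, hf.inv_right] at key
  rw [← sub_eq_zero, ← key]
  abel

end IsSteinbergSymbol

/-- A map on tuples of units satisfying the defining relations of Milnor K-theory. -/
structure IsMilnorSymbol {n : ℕ} (S : (Fin n → Fˣ) → A) : Prop where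
  update_mul : ∀ a i u v, S (Function.update a i (u * v)) =
    S (Function.update a i u) + S (Function.update a i v)
  eq_zero_of_add_eq_one : ∀ (a : Fin n → Fˣ) (i j : Fin n), (i : ℕ) + 1 = j →
    (a i : F) + a j = 1 → S a = 0

namespace IsMilnorSymbol

open Function

variable {n : ℕ} {S : (Fin n → Fˣ) → A}

theorem isSteinbergSymbol_update (hS : IsMilnorSymbol S) {i j : Fin n} (hij : i ≠ j)
    (h : ∀ a : Fin n → Fˣ, (a i : F) + a j = 1 → S a = 0) (a : Fin n → Fˣ) :
    IsSteinbergSymbol fun x y => S (update (update a i x) j y) where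
  mul_left x y z := by
    simp only [update_comm hij]
    exact hS.update_mul _ _ _ _
  mul_right x y z := hS.update_mul _ _ _ _
  eq_zero_of_add_eq_one x y hxy := h _ (by simpa [hij] using hxy)

theorem comp_swap (hS : IsMilnorSymbol S) {i j : Fin n} (hij : i ≠ j)
    (h : ∀ a : Fin n → Fˣ, (a i : F) + a j = 1 → S a = 0) (a : Fin n → Fˣ) :
    S (a ∘ Equiv.swap i j) = -S a := by
  have key := (hS.isSteinbergSymbol_update hij h a).eq_neg_swap (a j) (a i)
  have e : a ∘ Equiv.swap i j = update (update a i (a j)) j (a i) := by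
    rw [Equiv.comp_swap_eq_update, update_comm hij]
  rw [e]
  simpa using key

theorem eq_zero_of_add_eq_one_of_lt (hS : IsMilnorSymbol S)
    {i j : Fin n} (hij : i < j) (a : Fin n → Fˣ)
    (h : (a i : F) + a j = 1) : S a = 0 := by
  obtain ⟨i, hi⟩ := i
  obtain ⟨j, hj⟩ := j
  rw [Fin.mk_lt_mk] at hij
  induction j, hij using Nat.le_induction generalizing a with
  | base => exact hS.eq_zero_of_add_eq_one a _ _ rfl h
  | succ j hij ih =>
    have hj' : j < n := by omega
    have hs := hS.comp_swap (i := ⟨j, hj'⟩) (j := ⟨j + 1, hj⟩) (by simp)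
      (fun b => hS.eq_zero_of_add_eq_one b _ _ rfl) a
    rw [← neg_eq_zero, ← hs]
    refine ih _ hj' ?_
    rw [comp_apply, comp_apply, Equiv.swap_apply_left,
      Equiv.swap_apply_of_ne_of_ne (by simp; omega) (by simp; omega)]
    exact h

theorem eq_zero_of_add_eq_one_of_ne (hS : IsMilnorSymbol S)
    {i j : Fin n} (hij : i ≠ j) (a : Fin n → Fˣ)
    (h : (a i : F) + a j = 1) : S a = 0 := by
  rcases hij.lt_or_gt with h' | h'
  · exact hS.eq_zero_of_add_eq_one_of_lt h' a h
  · exact hS.eq_zero_of_add_eq_one_of_lt h' a (by rwa [add_comm])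

theorem eq_zero_of_sum_eq_zero (hS : IsMilnorSymbol S)
    (s : Finset (Fin n)) (hs : s.Nonempty) (a : Fin n → Fˣ)
    (h : ∑ i ∈ s, (a i : F) = 0) : S a = 0 := by
  induction hs using Finset.Nonempty.cons_induction generalizing a with
  | singleton i => simp at h
  | cons i s hi hs ih =>
    obtain ⟨j, hj⟩ := hs
    have hij : i ≠ j := fun e => hi (e ▸ hj)
    have hf := hS.isSteinbergSymbol_update hij
      (fun b => hS.eq_zero_of_add_eq_one_of_ne hij b) a
    have ha : S a = S (update (update a i (a i)) j (a j)) := by simp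
    rw [Finset.sum_cons, ← Finset.add_sum_erase _ _ hj, ← add_assoc] at h
    by_cases hc : (a i : F) + a j = 0
    · have e : a j = -a i := Units.ext (by simpa using eq_neg_of_add_eq_zero_right hc)
      rw [ha, e]
      exact hf.neg_self (a i)
    -- the value at `j` absorbs the value at `i`
    have merge : ∀ b : Fin n → Fˣ, b j = Units.mk0 _ hc →
        (∀ k, k ≠ i → k ≠ j → b k = a k) → S b = 0 := by
      intro b hbj hb
      refine ih b ?_
      rw [← Finset.add_sum_erase _ _ hj, hbj, ← h, Units.val_mk0]
      congr 1
      refine Finset.sum_congr rfl fun k hk => ?_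
      rw [hb k (fun e => hi (e ▸ Finset.mem_of_mem_erase hk)) (Finset.ne_of_mem_erase hk)]
    have key := hf.eq_of_add_eq (x := a i) (y := a j) (c := Units.mk0 _ hc) rfl
    have hsw := hf.eq_neg_swap (Units.mk0 _ hc) (a j)
    rw [ha, key, hsw, merge _ (by simp), merge _ (by simp), merge _ (by simp)]
    · simp
    all_goals
      intro k hki hkj
      simp [hki, hkj]

theorem update_mul_pow (hS : IsMilnorSymbol S)
    {p : ℕ} (hA : ∀ x : A, p • x = 0) (a : Fin n → Fˣ) (i : Fin n)
    (t : Fˣ) : S (update a i (a i * t ^ p)) = S a := by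
  let φ : Fˣ →* Multiplicative A :=
    { toFun := fun u => Multiplicative.ofAdd (S (update a i u))
      map_one' := by
        have h := hS.update_mul a i 1 1
        rw [mul_one, left_eq_add] at h
        rw [h, ofAdd_zero]
      map_mul' := fun u v => by rw [hS.update_mul, ofAdd_add] }
  have h : S (update a i (t ^ p)) = 0 := by
    have h' : φ (t ^ p) = 1 := by
      rw [map_pow]
      exact hA _
    exact h'
  rw [hS.update_mul, h, add_zero, update_eq_self]

theorem mul_pow_on (hS : IsMilnorSymbol S) {p : ℕ} (hA : ∀ x : A, p • x = 0) (a t : Fin n → Fˣ)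
    (s : Finset (Fin n)) : S (fun i => if i ∈ s then a i * t i ^ p else a i) = S a := by
  induction s using Finset.induction_on with
  | empty => simp
  | insert i s hi ih =>
    rw [← ih,
      ← hS.update_mul_pow hA (fun k => if k ∈ s then a k * t k ^ p else a k) i (t i)]
    congr 1
    ext k
    by_cases hk : k = i
    · subst hk
      simp [hi]
    · simp [hk]

theorem eq_zero_of_sum_mul_pow_eq_zero (hS : IsMilnorSymbol S)
    {p : ℕ} (hp : p ≠ 0) (hA : ∀ x : A, p • x = 0)
    (a : Fin n → Fˣ) (r : Fin n → F) (hr : r ≠ 0) (h : ∑ i, (a i : F) * r i ^ p = 0) :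
    S a = 0 := by
  classical
  let s := Finset.univ.filter fun i => r i ≠ 0
  let t : Fin n → Fˣ := fun i => if hi : r i = 0 then 1 else Units.mk0 (r i) hi
  rw [← hS.mul_pow_on hA a t s]
  obtain ⟨i, hi⟩ := Function.ne_iff.1 hr
  refine hS.eq_zero_of_sum_eq_zero s ⟨i, by simpa [s] using hi⟩ _ ?_
  rw [← h, Finset.sum_filter]
  refine Finset.sum_congr rfl fun k _ => ?_
  by_cases hk : r k = 0 <;> simp [s, t, hk, hp]

end IsMilnorSymbol

theorem isMilnorSymbol_symbol (p n : ℕ) :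
    IsMilnorSymbol fun a : Fin n → Fˣ => symbol F p a where
  update_mul a i u v := by
    have h : (QuotientAddGroup.mk' (milnorRel F n)) (FreeAbelianGroup.of
        (Function.update a i (u * v)) - FreeAbelianGroup.of (Function.update a i u)
          - FreeAbelianGroup.of (Function.update a i v)) = 0 :=
      (QuotientAddGroup.eq_zero_iff _).2 (AddSubgroup.subset_closure
        (Or.inl ⟨Function.update a i (u * v), i, u, v, by simp, by simp⟩))
    rw [map_sub, map_sub, sub_sub, sub_eq_zero] at h
    exact congrArg (QuotientAddGroup.mk' (pMul F p n)) h
  eq_zero_of_add_eq_one a i j hij h := by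
    have h' : (QuotientAddGroup.mk' (milnorRel F n)) (FreeAbelianGroup.of a) = 0 :=
      (QuotientAddGroup.eq_zero_iff _).2
        (AddSubgroup.subset_closure (Or.inr ⟨a, i, j, hij, h, rfl⟩))
    exact congrArg (QuotientAddGroup.mk' (pMul F p n)) h'

theorem nsmul_kMod_eq_zero (p n : ℕ) (x : kMod F p n) : p • x = 0 := by
  obtain ⟨y, rfl⟩ := QuotientAddGroup.mk_surjective x
  exact (QuotientAddGroup.eq_zero_iff (p • y)).2 (AddSubgroup.subset_closure ⟨y, rfl⟩)

theorem symbol_eq_zero_of_isotropic {p : ℕ} (hp : p ≠ 0) {n : ℕ} (a : Fin n → Fˣ)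
    (r : Fin n → F) (hr : r ≠ 0) (h : ∑ i, (a i : F) * r i ^ p = 0) : symbol F p a = 0 :=
  (isMilnorSymbol_symbol p n).eq_zero_of_sum_mul_pow_eq_zero hp (nsmul_kMod_eq_zero p n) a r hr h

end SteinbergSymbols

/-- Let `p` be a prime not equal to the characteristic of
`F` and `a_1, …, a_n ∈ F^*`.  If `a_1 r_1^p + ⋯ + a_n r_n^p = 0` for some
`r_1, …, r_n ∈ F` not all zero, then the symbol `(a_1, …, a_n)` is trivial in
`k_n(F)`.  Consequently, the diagonal form `a_1 t_1^p + ⋯ + a_n t_n^p` splits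
the symbol `(a_1, …, a_n)`. -/
theorem diagonal_form_splits (F : Type u) [Field F] (p : ℕ) (hp : p.Prime)
    (hchar : ringChar F ≠ p) (n : ℕ) (a : Fin n → Fˣ) :
    ((∃ r : Fin n → F, r ≠ 0 ∧ ∑ i : Fin n, (a i : F) * r i ^ p = 0) →
        symbol F p a = 0) ∧
    SplitsClass F p
      (∑ i : Fin n, MvPolynomial.C (a i : F) * MvPolynomial.X i ^ p)
      (symbol F p a) := by
  have hp0 := hp.ne_zero
  refine ⟨fun ⟨r, hr, h⟩ => symbol_eq_zero_of_isotropic hp0 a r hr h, ?_⟩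
  rintro L _ _ ⟨x, hx, h⟩
  refine symbol_eq_zero_of_isotropic hp0
    (Units.map (algebraMap F L).toMonoidHom ∘ a) x hx ?_
  simpa using h
end
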